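/- Let a ∈ (−1,1) and let V be bounded from above in ℝ^{n+1}_+ and satisfy L_a V ≤ 0 weakly in ℝ^{n+1}_+, i.e. V is a weak subsolution of div(y^a ∇V) = 0. Assume that V(x,0) ≤ 0 for all x ∈ ℝ^n, in the trace sense. Then V ≤ 0 in ℝ^{n+1}_+. -/

import Mathlib

open MeasureTheory Filter Metric Set

noncomputable section

/-- Euclidean space `ℝⁿ`. -/
abbrev En (n : ℕ) := EuclideanSpace ℝ (Fin n)

/-- The upper half space `ℝ^{n+1}_+` is modelled by `En n × ℝ`, points `p = (x,y)`
with `y = p.2 > 0`. -/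
abbrev Hn (n : ℕ) := En n × ℝ

/-- The Euclidean inner product of the gradients `∇V · ∇W` in `ℝ^{n+1}`. -/
def gradDot (n : ℕ) (V W : Hn n → ℝ) (p : Hn n) : ℝ :=
  (∑ i, fderiv ℝ V p (EuclideanSpace.single i 1, 0)
      * fderiv ℝ W p (EuclideanSpace.single i 1, 0))
    + fderiv ℝ V p ((0 : En n), (1:ℝ)) * fderiv ℝ W p ((0 : En n), (1:ℝ))

section Calculus

open scoped ContDiff

theorem tsupport_comp_sub_left_subset {E : Type*} [NormedAddCommGroup E] {φ : E → ℝ}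
    {ε : ℝ} (hφ : tsupport φ ⊆ closedBall 0 ε) (x : E) :
    tsupport (fun z => φ (x - z)) ⊆ closedBall x ε := by
  refine closure_minimal (fun z hz => ?_) isClosed_closedBall
  have := hφ (subset_tsupport _ hz)
  simpa [dist_eq_norm, norm_sub_rev] using this

theorem hasCompactSupport_comp_sub_left {E : Type*} [NormedAddCommGroup E] {φ : E → ℝ}
    (hφ : HasCompactSupport φ) (x : E) :
    HasCompactSupport (fun z => φ (x - z)) :=
  hφ.comp_homeomorph (Homeomorph.subLeft x)

theorem integrable_mul_of_eq_zero {E : Type*} [NormedAddCommGroup E] [MeasurableSpace E]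
    [BorelSpace E] {μ : Measure E} {f g : E → ℝ} {K : Set E} (hK : IsCompact K)
    (hf : IntegrableOn f K μ) (hg : Continuous g) (h0 : ∀ x ∉ K, g x = 0) :
    Integrable (fun p => f p * g p) μ := by
  have h1 : IntegrableOn (fun p => f p * g p) K μ := hf.mul_continuousOn hg.continuousOn hK
  refine (integrableOn_iff_integrable_of_support_subset fun x hx => ?_).1 h1
  by_contra hx'
  exact hx (by simp [h0 x hx'])

variable {E : Type*} [NormedAddCommGroup E] [NormedSpace ℝ E]

/-- The derivative of `f` in the direction `e`. -/
def pd (e : E) (f : E → ℝ) (p : E) : ℝ := fderiv ℝ f p e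

/-- The sum of the second derivatives of `f` in the directions `e i`. -/
def lap {ι : Type*} [Fintype ι] (e : ι → E) (f : E → ℝ) (p : E) : ℝ :=
  ∑ i, pd (e i) (pd (e i) f) p

theorem contDiff_pd {f : E → ℝ} (hf : ContDiff ℝ ∞ f) (e : E) : ContDiff ℝ ∞ (pd e f) :=
  (hf.fderiv_right (m := ∞) (by simp)).clm_apply contDiff_const

theorem contDiff_lap {ι : Type*} [Fintype ι] {f : E → ℝ} (hf : ContDiff ℝ ∞ f) (e : ι → E) :
    ContDiff ℝ ∞ (lap e f) :=
  ContDiff.sum fun i _ => contDiff_pd (contDiff_pd hf (e i)) (e i)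

theorem tsupport_pd_subset (e : E) (f : E → ℝ) : tsupport (pd e f) ⊆ tsupport f :=
  tsupport_fderiv_apply_subset ℝ e

theorem hasCompactSupport_pd {f : E → ℝ} (hf : HasCompactSupport f) (e : E) :
    HasCompactSupport (pd e f) :=
  hf.mono' ((subset_tsupport _).trans (tsupport_pd_subset e f))

theorem hasCompactSupport_lap {ι : Type*} [Fintype ι] {f : E → ℝ} (hf : HasCompactSupport f)
    (e : ι → E) : HasCompactSupport (lap e f) := by
  refine hf.mono' fun x hx => ?_
  by_contra hx'
  refine hx (Finset.sum_eq_zero fun i _ => ?_)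
  exact image_eq_zero_of_notMem_tsupport fun h =>
    hx' (tsupport_pd_subset _ _ (tsupport_pd_subset _ _ h))

theorem pd_mul {f g : E → ℝ} {p : E} (hf : DifferentiableAt ℝ f p) (hg : DifferentiableAt ℝ g p)
    (e : E) : pd e (fun z => f z * g z) p = f p * pd e g p + pd e f p * g p := by
  simp only [pd, fderiv_fun_mul hf hg]
  simp [mul_comm]

theorem pd_comp_smul_sub {η : E → ℝ} (hη : Differentiable ℝ η) (c : ℝ) (e x z : E) :
    pd e (fun z => η (c • (z - x))) z = c * pd e η (c • (z - x)) := by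
  have h : HasFDerivAt (fun z => c • (z - x)) (c • ContinuousLinearMap.id ℝ E) z :=
    ((hasFDerivAt_id z).sub_const x).const_smul c
  have h2 : HasFDerivAt (fun z => η (c • (z - x))) _ z := (hη _).hasFDerivAt.comp z h
  simp only [pd]
  rw [h2.fderiv]
  simp

theorem pd_const_mul {f : E → ℝ} (c : ℝ) (e p : E) :
    pd e (fun z => c * f z) p = c * pd e f p := by
  have : (fun z => c * f z) = c • f := rfl
  simp only [pd, this, fderiv_const_smul_field]
  rfl

theorem pd_comp_sub_left {φ : E → ℝ} (hφ : Differentiable ℝ φ) (e x z : E) :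
    pd e (fun z => φ (x - z)) z = - pd e φ (x - z) := by
  simpa using pd_comp_smul_sub hφ (-1) e x z

theorem lap_comp_smul_sub {ι : Type*} [Fintype ι] {η : E → ℝ} (hη : ContDiff ℝ ∞ η) (c : ℝ)
    (e : ι → E) (x z : E) :
    lap e (fun z => η (c • (z - x))) z = c ^ 2 * lap e η (c • (z - x)) := by
  simp only [lap, Finset.mul_sum]
  refine Finset.sum_congr rfl fun i _ => ?_
  have hd : Differentiable ℝ (pd (e i) η) := (contDiff_pd hη (e i)).differentiable (by simp)
  have : pd (e i) (fun z => η (c • (z - x))) =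
      fun z => (fun y => c * pd (e i) η y) (c • (z - x)) := by
    ext z
    exact pd_comp_smul_sub (hη.differentiable (by simp)) c (e i) x z
  rw [this, pd_comp_smul_sub (hd.const_mul c), pd_const_mul]
  ring

theorem lap_comp_sub_left {ι : Type*} [Fintype ι] {φ : E → ℝ} (hφ : ContDiff ℝ ∞ φ) (e : ι → E)
    (x z : E) : lap e (fun z => φ (x - z)) z = lap e φ (x - z) := by
  simpa using lap_comp_smul_sub hφ (-1) e x z

variable [FiniteDimensional ℝ E] [MeasurableSpace E] [BorelSpace E]
  (μ : Measure E) [μ.IsAddHaarMeasure]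

/-- The convolution of the scalar functions `φ` and `g`. -/
def mol (φ g : E → ℝ) : E → ℝ := convolution φ g (ContinuousLinearMap.lsmul ℝ ℝ) μ

variable {μ}

theorem mol_apply (φ g : E → ℝ) (x : E) : mol μ φ g x = ∫ z, φ (x - z) * g z ∂μ := by
  simp [mol, convolution_eq_swap]

theorem contDiff_mol {φ g : E → ℝ} (hφ : ContDiff ℝ ∞ φ) (hc : HasCompactSupport φ)
    (hg : LocallyIntegrable g μ) : ContDiff ℝ ∞ (mol μ φ g) :=
  hc.contDiff_convolution_left _ hφ hg

theorem pd_mol {φ g : E → ℝ} (hφ : ContDiff ℝ ∞ φ) (hc : HasCompactSupport φ)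
    (hg : LocallyIntegrable g μ) (e : E) : pd e (mol μ φ g) = mol μ (pd e φ) g := by
  ext x
  have h := hc.hasFDerivAt_convolution_left (ContinuousLinearMap.lsmul ℝ ℝ)
    (hφ.of_le (by norm_cast)) hg x
  have hi : Integrable (fun t => (((ContinuousLinearMap.lsmul ℝ ℝ).precompL E)
      (fderiv ℝ φ t)) (g (x - t))) μ :=
    (hc.fderiv (𝕜 := ℝ)).convolutionExists_left _ (hφ.continuous_fderiv (by simp)) hg x
  simp only [pd, mol]
  rw [h.fderiv, convolution_def, convolution_def, ContinuousLinearMap.integral_apply hi]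
  simp [pd]

theorem lap_mol {ι : Type*} [Fintype ι] {φ g : E → ℝ} (hφ : ContDiff ℝ ∞ φ)
    (hc : HasCompactSupport φ) (hg : LocallyIntegrable g μ) (e : ι → E) (x : E) :
    lap e (mol μ φ g) x = ∫ z, lap e (fun z => φ (x - z)) z * g z ∂μ := by
  simp only [lap_comp_sub_left hφ]
  simp only [lap, Finset.sum_mul]
  rw [integral_finsetSum]
  · refine Finset.sum_congr rfl fun i _ => ?_
    rw [pd_mol hφ hc hg, pd_mol (contDiff_pd hφ _) (hasCompactSupport_pd hc _) hg, mol_apply]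
  · intro i _
    have h := (hasCompactSupport_pd (hasCompactSupport_pd hc (e i)) (e i)).convolutionExists_left
      (ContinuousLinearMap.lsmul ℝ ℝ) (contDiff_pd (contDiff_pd hφ (e i)) (e i)).continuous hg x
    have h2 := h.integrable_swap
    simpa using h2

/-- Integration by parts against a compactly supported test function. -/
theorem integral_pd_mul {V ψ : E → ℝ} (hψ : ContDiff ℝ ∞ ψ) (hc : HasCompactSupport ψ)
    (hV : ∀ p ∈ tsupport ψ, DifferentiableAt ℝ V p) (e : E)
    (hi : IntegrableOn (pd e V) (tsupport ψ) μ) :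
    Integrable (fun p => pd e V p * ψ p) μ ∧ Integrable (fun p => V p * pd e ψ p) μ ∧
    ∫ p, pd e V p * ψ p ∂μ = - ∫ p, V p * pd e ψ p ∂μ := by
  have hVc : ContinuousOn V (tsupport ψ) := fun p hp => (hV p hp).continuousAt.continuousWithinAt
  have hVi : IntegrableOn V (tsupport ψ) μ := hVc.integrableOn_compact hc
  have h1 := integrable_mul_of_eq_zero hc (g := ψ) hi hψ.continuous fun x hx =>
    image_eq_zero_of_notMem_tsupport hx
  have h2 := integrable_mul_of_eq_zero hc (g := pd e ψ) hVi (contDiff_pd hψ e).continuous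
    fun x hx =>
    image_eq_zero_of_notMem_tsupport fun h => hx (tsupport_pd_subset e ψ h)
  have h3 := integrable_mul_of_eq_zero hc (g := ψ) hVi hψ.continuous fun x hx =>
    image_eq_zero_of_notMem_tsupport hx
  refine ⟨h1, h2, ?_⟩
  have := integral_mul_fderiv_eq_neg_fderiv_mul_of_integrable (μ := μ) (f := V) (g := ψ) (v := e)
    h1 h2 h3 hV fun x _ => hψ.differentiable (by simp) x
  simp only [pd] at this ⊢
  rw [this, neg_neg]

theorem pd_mol_indicator {φ v : E → ℝ} (hφ : ContDiff ℝ ∞ φ) (hc : HasCompactSupport φ)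
    {K : Set E} (hK : IsCompact K) (hv : ∀ p ∈ K, DifferentiableAt ℝ v p) (e : E)
    (hi : IntegrableOn (pd e v) K μ) {x : E} (hx : tsupport (fun z => φ (x - z)) ⊆ K) :
    pd e (mol μ φ (K.indicator v)) x = mol μ φ (K.indicator (pd e v)) x := by
  have hvc : ContinuousOn v K := fun p hp => (hv p hp).continuousAt.continuousWithinAt
  have hvi : LocallyIntegrable (K.indicator v) μ :=
    ((hvc.integrableOn_compact hK).integrable_indicator hK.measurableSet).locallyIntegrable
  have hψ : ContDiff ℝ ∞ (fun z => φ (x - z)) := hφ.comp (contDiff_const.sub contDiff_id)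
  have hψc := hasCompactSupport_comp_sub_left hc x
  have h := (integral_pd_mul (μ := μ) hψ hψc (fun p hp => hv p (hx hp)) e (hi.mono_set hx)).2.2
  rw [pd_mol hφ hc hvi, mol_apply, mol_apply]
  have e1 : ∀ z, pd e φ (x - z) * K.indicator v z = - (v z * pd e (fun z => φ (x - z)) z) := by
    intro z
    rw [pd_comp_sub_left (hφ.differentiable (by simp))]
    by_cases hz : z ∈ K
    · simp [hz, mul_comm]
    · have : pd e (fun z => φ (x - z)) z = 0 :=
        image_eq_zero_of_notMem_tsupport fun h => hz (hx (tsupport_pd_subset _ _ h))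
      rw [pd_comp_sub_left (hφ.differentiable (by simp))] at this
      simp [hz, this]
  have e2 : ∀ z, φ (x - z) * K.indicator (pd e v) z = pd e v z * φ (x - z) := by
    intro z
    by_cases hz : z ∈ K
    · simp [hz, mul_comm]
    · have : φ (x - z) = 0 :=
        image_eq_zero_of_notMem_tsupport (f := fun z => φ (x - z)) fun h => hz (hx h)
      simp [hz, this]
  simp only [e1, e2, integral_neg]
  exact h.symm

/-- Energy estimate for a nonnegative smooth function whose Laplacian is bounded below. -/
theorem caccioppoli {ι : Type*} [Fintype ι] (e : ι → E) {w η : E → ℝ} (hw : ContDiff ℝ ∞ w)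
    (hη : ContDiff ℝ ∞ η) (hc : HasCompactSupport η) (hη0 : ∀ p, 0 ≤ η p) {F : ℝ}
    (hpos : ∀ p ∈ tsupport η, 0 ≤ w p) (hlap : ∀ p ∈ tsupport η, -F ≤ lap e w p) :
    ∫ p, η p * ∑ i, pd (e i) w p ^ 2 ∂μ ≤
      1 / 2 * ∫ p, w p ^ 2 * lap e η p ∂μ + F * ∫ p, η p * w p ∂μ := by
  have hw2 : ContDiff ℝ ∞ (fun p => w p * w p) := hw.mul hw
  have hd : Differentiable ℝ w := hw.differentiable (by simp)
  have hint : ∀ f g : E → ℝ, Continuous f → Continuous g → HasCompactSupport g →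
      Integrable (fun p => f p * g p) μ := fun f g hf hg hgc =>
    (hf.mul hg).integrable_of_hasCompactSupport hgc.mul_left
  have ibp : ∀ f g : E → ℝ, ContDiff ℝ ∞ f → ContDiff ℝ ∞ g → HasCompactSupport g → ∀ i,
      ∫ p, pd (e i) f p * g p ∂μ = - ∫ p, f p * pd (e i) g p ∂μ := fun f g hf hg hgc i =>
    (integral_pd_mul hg hgc (fun p _ => hf.differentiable (by simp) p) (e i)
      ((contDiff_pd hf (e i)).continuous.continuousOn.integrableOn_compact hgc)).2.2
  have h1 : ∫ p, lap e (fun p => w p * w p) p * η p ∂μ = ∫ p, w p ^ 2 * lap e η p ∂μ := by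
    simp only [lap, Finset.sum_mul, Finset.mul_sum]
    rw [integral_finsetSum _ fun i _ => hint _ _
        (contDiff_pd (contDiff_pd hw2 _) _).continuous hη.continuous hc,
      integral_finsetSum _ fun i _ => hint (fun p => w p ^ 2) _ (hw.continuous.pow 2)
        (contDiff_pd (contDiff_pd hη _) _).continuous
        (hasCompactSupport_pd (hasCompactSupport_pd hc _) _)]
    refine Finset.sum_congr rfl fun i _ => ?_
    rw [ibp _ _ (contDiff_pd hw2 _) hη hc, ibp _ _ hw2 (contDiff_pd hη _)
      (hasCompactSupport_pd hc _), neg_neg]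
    simp [sq]
  have h2 : ∀ p, lap e (fun p => w p * w p) p = 2 * (w p * lap e w p) +
      2 * ∑ i, pd (e i) w p ^ 2 := by
    intro p
    simp only [lap, Finset.mul_sum, ← Finset.sum_add_distrib]
    refine Finset.sum_congr rfl fun i _ => ?_
    have e1 : pd (e i) (fun p => w p * w p) = fun p => (2 * w p) * pd (e i) w p := by
      ext z
      rw [pd_mul (hd z) (hd z)]
      ring
    have hd1 : Differentiable ℝ (pd (e i) w) := (contDiff_pd hw (e i)).differentiable (by simp)
    rw [e1, pd_mul ((hd p).const_mul 2) (hd1 p), pd_const_mul]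
    ring
  have hsq : Continuous (fun p => ∑ i, pd (e i) w p ^ 2) :=
    continuous_finsetSum _ fun i _ => (contDiff_pd hw (e i)).continuous.pow 2
  have i1 := hint _ η hsq hη.continuous hc
  have i2 := hint _ η hw.continuous hη.continuous hc
  have i3 := hint _ η (contDiff_lap hw2 e).continuous hη.continuous hc
  have h3 : ∫ p, η p * ∑ i, pd (e i) w p ^ 2 ∂μ ≤
      ∫ p, (1 / 2 * (lap e (fun p => w p * w p) p * η p) + F * (w p * η p)) ∂μ := by
    refine integral_mono (by simpa [mul_comm] using i1)
      ((i3.const_mul _).add (i2.const_mul _)) fun p => ?_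
    simp only [h2]
    by_cases hp : p ∈ tsupport η
    · have := mul_nonneg (mul_nonneg (hη0 p) (hpos p hp)) (by linarith [hlap p hp] :
        0 ≤ lap e w p + F)
      nlinarith
    · simp [image_eq_zero_of_notMem_tsupport hp]
  rw [integral_add (i3.const_mul _) (i2.const_mul _), integral_const_mul, integral_const_mul,
    h1] at h3
  simpa [mul_comm] using h3

theorem le_mol {φ g : E → ℝ} (hφ : ContDiff ℝ ∞ φ) (hc : HasCompactSupport φ)
    (h0 : ∀ p, 0 ≤ φ p) (h1 : ∫ p, φ p ∂μ = 1) (hg : LocallyIntegrable g μ) {x : E} {c : ℝ}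
    (h : ∀ z, φ (x - z) ≠ 0 → c ≤ g z) : c ≤ mol μ φ g x := by
  have hi : Integrable (fun z => φ (x - z) * g z) μ := by
    simpa using (hc.convolutionExists_left (ContinuousLinearMap.lsmul ℝ ℝ) hφ.continuous
      hg x).integrable_swap
  have hi2 : Integrable (fun z => φ (x - z) * c) μ :=
    ((hφ.continuous.integrable_of_hasCompactSupport hc).comp_sub_left x).mul_const c
  have e : ∫ z, φ (x - z) * c ∂μ = c := by
    rw [integral_mul_const, integral_sub_left_eq_self, h1, one_mul]
  rw [mol_apply, ← e]
  refine integral_mono hi2 hi fun z => ?_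
  by_cases hz : φ (x - z) = 0
  · simp [hz]
  · exact mul_le_mul_of_nonneg_left (h z hz) (h0 _)

theorem mol_le {φ g : E → ℝ} (hφ : ContDiff ℝ ∞ φ) (hc : HasCompactSupport φ)
    (h0 : ∀ p, 0 ≤ φ p) (h1 : ∫ p, φ p ∂μ = 1) (hg : LocallyIntegrable g μ) {x : E} {c : ℝ}
    (h : ∀ z, φ (x - z) ≠ 0 → g z ≤ c) : mol μ φ g x ≤ c := by
  have := le_mol hφ hc h0 h1 hg.neg (x := x) (c := -c) fun z hz => neg_le_neg (h z hz)
  rw [mol_apply] at this ⊢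
  simpa [integral_neg] using this

theorem exists_lintegral_enorm_pd_le {ι : Type*} [Fintype ι] (e : ι → E) :
    ∃ C : ℝ, ∀ (w : E → ℝ) (x : E) (d M F : ℝ), ContDiff ℝ ∞ w → 0 < d → 0 ≤ M → 0 ≤ F →
      (∀ p ∈ closedBall x d, |w p| ≤ M) → (∀ p ∈ closedBall x d, -F ≤ lap e w p) → ∀ j,
      ∫⁻ p in closedBall x (d / 2), ‖pd (e j) w p‖ₑ ∂μ ≤
        ENNReal.ofReal (1 + (2 * C * (M / d) ^ 2 + 2 * F * M)) * μ (closedBall x d) := by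
  let η₀ : ContDiffBump (0 : E) := ⟨1 / 2, 1, by norm_num, by norm_num⟩
  have hη₀ : ContDiff ℝ ∞ η₀ := η₀.contDiff
  obtain ⟨C, hC⟩ := (contDiff_lap hη₀ e).continuous.bounded_above_of_compact_support
    (hasCompactSupport_lap η₀.hasCompactSupport e)
  have hC0 : 0 ≤ C := (norm_nonneg _).trans (hC 0)
  refine ⟨C, fun w x d M F hw hd hM hF hwM hlap j => ?_⟩
  set η : E → ℝ := fun z => η₀ (d⁻¹ • (z - x)) with hηdef
  have hη : ContDiff ℝ ∞ η := hη₀.comp (contDiff_const.smul (contDiff_id.sub contDiff_const))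
  have hnorm : ∀ z, ‖d⁻¹ • (z - x)‖ = dist z x / d := by
    intro z
    rw [norm_smul, dist_eq_norm, norm_inv, Real.norm_of_nonneg hd.le]
    ring
  have hsupp : tsupport η ⊆ closedBall x d := by
    refine closure_minimal (fun z hz => ?_) isClosed_closedBall
    by_contra hz'
    refine hz (η₀.zero_of_le_dist ?_)
    rw [dist_zero_right, hnorm]
    simp only [mem_closedBall, not_le] at hz'
    exact (one_le_div hd).2 hz'.le
  have hc : HasCompactSupport η :=
    (isCompact_closedBall x d).of_isClosed_subset (isClosed_tsupport η) hsupp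
  have hη0 : ∀ p, 0 ≤ η p := fun p => η₀.nonneg
  have hη1 : ∀ p, η p ≤ 1 := fun p => η₀.le_one
  have hone : ∀ p ∈ closedBall x (d / 2), η p = 1 := by
    intro p hp
    refine η₀.one_of_mem_closedBall ?_
    rw [mem_closedBall, dist_zero_right, hnorm, div_le_iff₀ hd]
    have : dist p x ≤ d / 2 := hp
    change dist p x ≤ 1 / 2 * d
    linarith
  have hwM' : ContDiff ℝ ∞ (fun p => w p + M) := hw.add contDiff_const
  have hpd : ∀ i, pd (e i) (fun p => w p + M) = pd (e i) w := by
    intro i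
    ext p
    simp only [pd, fderiv_add_const]
  have hlap' : lap e (fun p => w p + M) = lap e w := by
    ext p
    simp only [lap, hpd]
  have hcac := caccioppoli (μ := μ) e hwM' hη hc hη0 (F := F)
    (fun p hp => by linarith [neg_le_of_abs_le (hwM p (hsupp hp))])
    (fun p hp => by rw [hlap']; exact hlap p (hsupp hp))
  simp only [hpd] at hcac
  have hfin : μ (closedBall x d) < ⊤ := (isCompact_closedBall x d).measure_lt_top
  have hb1 : ∫ p, (w p + M) ^ 2 * lap e η p ∂μ ≤ (4 * M ^ 2 * (C / d ^ 2)) *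
      μ.real (closedBall x d) := by
    rw [← setIntegral_eq_integral_of_forall_compl_eq_zero (s := closedBall x d)]
    · refine (Real.le_norm_self _).trans (norm_setIntegral_le_of_norm_le_const hfin fun p hp => ?_)
      rw [norm_mul, hηdef, lap_comp_smul_sub hη₀, norm_mul]
      have h1 := abs_le.1 (hwM p hp)
      have h2 : ‖(w p + M) ^ 2‖ ≤ 4 * M ^ 2 := by
        rw [Real.norm_of_nonneg (sq_nonneg _)]
        nlinarith
      have h3 : ‖d⁻¹ ^ 2‖ * ‖lap e η₀ (d⁻¹ • (p - x))‖ ≤ C / d ^ 2 := by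
        rw [Real.norm_of_nonneg (by positivity), inv_pow, inv_mul_eq_div]
        gcongr
        exact hC _
      gcongr
    · intro p hp
      have : lap e η p = 0 := Finset.sum_eq_zero fun i _ =>
        image_eq_zero_of_notMem_tsupport fun h =>
          hp (hsupp (tsupport_pd_subset _ _ (tsupport_pd_subset _ _ h)))
      simp [this]
  have hb2 : ∫ p, η p * (w p + M) ∂μ ≤ (2 * M) * μ.real (closedBall x d) := by
    rw [← setIntegral_eq_integral_of_forall_compl_eq_zero (s := closedBall x d)]
    · refine (Real.le_norm_self _).trans (norm_setIntegral_le_of_norm_le_const hfin fun p hp => ?_)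
      have h1 := abs_le.1 (hwM p hp)
      rw [norm_mul, Real.norm_of_nonneg (hη0 p), Real.norm_of_nonneg (by linarith)]
      nlinarith [hη0 p, hη1 p]
    · intro p hp
      rw [image_eq_zero_of_notMem_tsupport fun h => hp (hsupp h), zero_mul]
  have hb3 : ∫ p, η p * ∑ i, pd (e i) w p ^ 2 ∂μ ≤
      (2 * C * (M / d) ^ 2 + 2 * F * M) * μ.real (closedBall x d) := by
    refine hcac.trans ?_
    calc _ ≤ 1 / 2 * ((4 * M ^ 2 * (C / d ^ 2)) * μ.real (closedBall x d)) +
          F * ((2 * M) * μ.real (closedBall x d)) := by gcongr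
      _ = _ := by ring
  have hsq : Continuous (fun p => ∑ i, pd (e i) w p ^ 2) :=
    continuous_finsetSum _ fun i _ => (contDiff_pd hw (e i)).continuous.pow 2
  have hint : Integrable (fun p => η p * ∑ i, pd (e i) w p ^ 2) μ :=
    (hη.continuous.mul hsq).integrable_of_hasCompactSupport hc.mul_right
  have hS : ∀ p, 0 ≤ ∑ i, pd (e i) w p ^ 2 := fun p => Finset.sum_nonneg fun i _ => sq_nonneg _
  have hle : ∫⁻ p in closedBall x (d / 2), ‖pd (e j) w p‖ₑ ∂μ ≤
      ∫⁻ p in closedBall x (d / 2), (1 + ENNReal.ofReal (η p * ∑ i, pd (e i) w p ^ 2)) ∂μ := by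
    refine setLIntegral_mono' measurableSet_closedBall fun p hp => ?_
    rw [hone p hp, one_mul, ← ENNReal.ofReal_one, ← ENNReal.ofReal_add zero_le_one (hS p),
      Real.enorm_eq_ofReal_abs]
    refine ENNReal.ofReal_le_ofReal ?_
    have h1 : pd (e j) w p ^ 2 ≤ ∑ i, pd (e i) w p ^ 2 :=
      Finset.single_le_sum (f := fun i => pd (e i) w p ^ 2) (fun i _ => sq_nonneg _)
        (Finset.mem_univ j)
    nlinarith [sq_abs (pd (e j) w p), sq_nonneg (|pd (e j) w p| - 1), abs_nonneg (pd (e j) w p)]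
  refine hle.trans ?_
  rw [lintegral_add_left measurable_const, ENNReal.ofReal_add zero_le_one (by positivity), add_mul,
    ENNReal.ofReal_one, one_mul]
  refine add_le_add ?_ ?_
  · simpa using measure_mono (closedBall_subset_closedBall (by linarith))
  · refine (setLIntegral_le_lintegral _ _).trans ?_
    rw [← ofReal_integral_eq_lintegral_ofReal hint (ae_of_all _ fun p => mul_nonneg (hη0 p) (hS p))]
    refine (ENNReal.ofReal_le_ofReal hb3).trans_eq ?_
    rw [ENNReal.ofReal_mul (by positivity), Measure.real, ENNReal.ofReal_toReal hfin.ne]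

end Calculus

section HalfSpace

open scoped ContDiff Topology

instance isAddHaarMeasure_volume_Hn (n : ℕ) : (volume : Measure (Hn n)).IsAddHaarMeasure :=
  Measure.prod.instIsAddHaarMeasure volume volume

/-- The standard basis of `ℝ^{n+1}`; the vertical direction has index `none`. -/
def ev (n : ℕ) : Option (Fin n) → Hn n
  | none => (0, 1)
  | some i => (EuclideanSpace.single i 1, 0)

theorem gradDot_eq_sum (n : ℕ) (V W : Hn n → ℝ) (p : Hn n) :
    gradDot n V W p = ∑ j, pd (ev n j) V p * pd (ev n j) W p := by
  rw [Fintype.sum_option, add_comm]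
  rfl

theorem sum_ev_snd (n : ℕ) (c : ℝ) : ∑ j, (ev n j).2 * c = c := by
  simp [Fintype.sum_option, ev]

theorem ev_snd_mul_self (n : ℕ) (j : Option (Fin n)) : (ev n j).2 * (ev n j).2 = (ev n j).2 := by
  cases j <;> simp [ev]

theorem norm_ev_le (n : ℕ) (j : Option (Fin n)) : ‖ev n j‖ ≤ 1 := by
  cases j <;> simp [ev, Prod.norm_def]

theorem isOpen_upper (n : ℕ) : IsOpen {p : Hn n | 0 < p.2} :=
  isOpen_lt continuous_const continuous_snd

theorem contDiffAt_rpow_snd {n : ℕ} (s : ℝ) {p : Hn n} (hp : 0 < p.2) :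
    ContDiffAt ℝ ∞ (fun z : Hn n => z.2 ^ s) p :=
  contDiffAt_snd.rpow_const_of_ne hp.ne'

theorem pd_rpow_snd {n : ℕ} (s : ℝ) {p : Hn n} (hp : 0 < p.2) (e : Hn n) :
    pd e (fun z => z.2 ^ s) p = s * e.2 * p.2 ^ (s - 1) := by
  have h : HasFDerivAt (fun z : Hn n => z.2) (ContinuousLinearMap.snd ℝ (En n) ℝ) p :=
    hasFDerivAt_snd
  simp only [pd]
  rw [(h.rpow_const (Or.inl hp.ne')).fderiv]
  simp
  ring

theorem pd_rpow_mul {n : ℕ} (s : ℝ) {f : Hn n → ℝ} {p : Hn n} (hp : 0 < p.2)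
    (hf : DifferentiableAt ℝ f p) (e : Hn n) :
    pd e (fun z => z.2 ^ s * f z) p =
      p.2 ^ s * pd e f p + s * e.2 * (p.2 ^ (s - 1) * f p) := by
  rw [pd_mul ((contDiffAt_rpow_snd s hp).differentiableAt (by simp)) hf, pd_rpow_snd s hp]
  ring

theorem contDiff_rpow_mul {n : ℕ} (s : ℝ) {ξ : Hn n → ℝ} (hξ : ContDiff ℝ ∞ ξ)
    (hs : tsupport ξ ⊆ {p | 0 < p.2}) : ContDiff ℝ ∞ (fun z => z.2 ^ s * ξ z) := by
  refine contDiff_iff_contDiffAt.2 fun p => ?_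
  by_cases hp : p ∈ tsupport ξ
  · exact (contDiffAt_rpow_snd s (hs hp)).mul hξ.contDiffAt
  · have : (fun z : Hn n => z.2 ^ s * ξ z) =ᶠ[𝓝 p] fun _ => 0 := by
      filter_upwards [(isClosed_tsupport ξ).isOpen_compl.mem_nhds hp] with z hz
      simp [image_eq_zero_of_notMem_tsupport hz]
    exact contDiffAt_const.congr_of_eventuallyEq this

/-- `V` is differentiable in the open half space and a weak subsolution of `div (y ^ a ∇ V) = 0`,
in the sense that the defining inequality holds for all test functions. -/
structure WeakSub (n : ℕ) (a : ℝ) (V : Hn n → ℝ) : Prop where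
  differentiableAt : ∀ p : Hn n, 0 < p.2 → DifferentiableAt ℝ V p
  integral_le : ∀ ξ : Hn n → ℝ, ContDiff ℝ (⊤ : ℕ∞) ξ → HasCompactSupport ξ →
      tsupport ξ ⊆ {p : Hn n | 0 < p.2} → (∀ p, 0 ≤ ξ p) →
      (∫ p in {p : Hn n | 0 < p.2}, p.2 ^ a * gradDot n V ξ p) ≤ 0

theorem WeakSub.sub_const {n : ℕ} {a : ℝ} {V : Hn n → ℝ} (h : WeakSub n a V) (c : ℝ) :
    WeakSub n a (fun p => V p - c) where
  differentiableAt p hp := (h.differentiableAt p hp).sub_const c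
  integral_le ξ h1 h2 h3 h4 := by
    have : ∀ p, gradDot n (fun p => V p - c) ξ p = gradDot n V ξ p := by
      intro p
      simp only [gradDot, fderiv_sub_const]
    simpa only [this] using h.integral_le ξ h1 h2 h3 h4

/-- Very weak formulation: `v = y ^ (a / 2) V` satisfies
`Δ v ≥ (a / 2) (a / 2 - 1) y ^ (-2) v` wherever the gradient of `V` is integrable. -/
theorem WeakSub.integral_lap_ge {n : ℕ} {a s : ℝ} (hs : a = 2 * s) {V : Hn n → ℝ}
    (h : WeakSub n a V) {ξ : Hn n → ℝ} (hξ : ContDiff ℝ ∞ ξ) (hc : HasCompactSupport ξ)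
    (hH : tsupport ξ ⊆ {p | 0 < p.2}) (h0 : ∀ p, 0 ≤ ξ p)
    (hi : ∀ j, IntegrableOn (pd (ev n j) V) (tsupport ξ)) :
    ∫ p, ξ p * (s * (s - 1) * (p.2 ^ (s - 2) * V p)) ≤
      ∫ p, lap (ev n) ξ p * (p.2 ^ s * V p) := by
  have hVc : ContinuousOn V (tsupport ξ) := fun p hp =>
    (h.differentiableAt p (hH hp)).continuousAt.continuousWithinAt
  have hpc : ∀ r : ℝ, ContinuousOn (fun p : Hn n => p.2 ^ r) (tsupport ξ) := fun r p hp =>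
    (contDiffAt_rpow_snd r (hH hp)).continuousAt.continuousWithinAt
  have hξ0 : ∀ p ∉ tsupport ξ, ξ p = 0 := fun p hp => image_eq_zero_of_notMem_tsupport hp
  have hdξ0 : ∀ j, ∀ p ∉ tsupport ξ, pd (ev n j) ξ p = 0 := fun j p hp =>
    image_eq_zero_of_notMem_tsupport fun h => hp (tsupport_pd_subset _ _ h)
  have hlξ0 : ∀ p ∉ tsupport ξ, lap (ev n) ξ p = 0 := fun p hp =>
    Finset.sum_eq_zero fun j _ => image_eq_zero_of_notMem_tsupport fun h => hp
      (tsupport_pd_subset _ _ (tsupport_pd_subset _ _ h))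
  set ψ : Option (Fin n) → Hn n → ℝ := fun j z =>
    z.2 ^ s * pd (ev n j) ξ z + (-s * (ev n j).2) * (z.2 ^ (s - 1) * ξ z) with hψdef
  have hψ : ∀ j, ContDiff ℝ ∞ (ψ j) := fun j =>
    (contDiff_rpow_mul s (contDiff_pd hξ _) ((tsupport_pd_subset _ _).trans hH)).add
      (contDiff_const.mul (contDiff_rpow_mul (s - 1) hξ hH))
  have hψs : ∀ j, tsupport (ψ j) ⊆ tsupport ξ := fun j => by
    refine closure_minimal (fun z hz => ?_) (isClosed_tsupport ξ)
    by_contra hz'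
    exact hz (by simp [hψdef, hξ0 z hz', hdξ0 j z hz'])
  have hψc : ∀ j, HasCompactSupport (ψ j) := fun j =>
    hc.mono' ((subset_tsupport _).trans (hψs j))
  have ibp := fun j => integral_pd_mul (μ := volume) (hψ j) (hψc j)
    (fun p hp => h.differentiableAt p (hH (hψs j hp))) (ev n j) ((hi j).mono_set (hψs j))
  have hζ : ContDiff ℝ ∞ (fun z => z.2 ^ (-s) * ξ z) := contDiff_rpow_mul _ hξ hH
  have hζs : tsupport (fun z : Hn n => z.2 ^ (-s) * ξ z) ⊆ tsupport ξ := tsupport_mul_subset_right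
  have key := h.integral_le _ hζ (hc.mono' ((subset_tsupport _).trans hζs)) (hζs.trans hH) <| by
    intro p
    by_cases hp : p ∈ tsupport ξ
    · exact mul_nonneg (Real.rpow_nonneg (le_of_lt (hH hp)) _) (h0 p)
    · simp [hξ0 p hp]
  have e1 : ∫ p in {p : Hn n | 0 < p.2}, p.2 ^ a * gradDot n V (fun z => z.2 ^ (-s) * ξ z) p =
      ∑ j, ∫ p, pd (ev n j) V p * ψ j p := by
    rw [← integral_finsetSum _ fun j _ => (ibp j).1,
      ← setIntegral_eq_integral_of_forall_compl_eq_zero (s := {p : Hn n | 0 < p.2})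
        (f := fun p => ∑ j, pd (ev n j) V p * ψ j p)]
    · refine setIntegral_congr_fun (isOpen_upper n).measurableSet fun p (hp : 0 < p.2) => ?_
      simp only [gradDot_eq_sum, Finset.mul_sum]
      refine Finset.sum_congr rfl fun j _ => ?_
      rw [pd_rpow_mul _ hp (hξ.differentiable (by simp) p)]
      have r1 : p.2 ^ a * p.2 ^ (-s) = p.2 ^ s := by
        rw [← Real.rpow_add hp]; congr 1; linarith
      have r2 : p.2 ^ a * p.2 ^ (-s - 1) = p.2 ^ (s - 1) := by
        rw [← Real.rpow_add hp]; congr 1; linarith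
      simp only [hψdef, ← r1, ← r2]
      ring
    · intro p hp
      refine Finset.sum_eq_zero fun j _ => ?_
      have hp' : p ∉ tsupport ξ := fun h => hp (hH h)
      simp [hψdef, hξ0 p hp', hdξ0 j p hp']
  rw [e1, Finset.sum_congr rfl fun j _ => (ibp j).2.2, Finset.sum_neg_distrib,
    ← integral_finsetSum _ fun j _ => (ibp j).2.1] at key
  have e2 : ∀ p, ∑ j, V p * pd (ev n j) (ψ j) p = lap (ev n) ξ p * (p.2 ^ s * V p) -
      ξ p * (s * (s - 1) * (p.2 ^ (s - 2) * V p)) := by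
    intro p
    by_cases hp : p ∈ tsupport ξ
    · have hp0 : 0 < p.2 := hH hp
      have : ∀ j, V p * pd (ev n j) (ψ j) p = V p * (p.2 ^ s * pd (ev n j) (pd (ev n j) ξ) p) -
          (ev n j).2 * (ξ p * (s * (s - 1) * (p.2 ^ (s - 2) * V p))) := by
        intro j
        have d1 := (contDiff_rpow_mul s (contDiff_pd hξ (ev n j))
          ((tsupport_pd_subset _ _).trans hH)).differentiable (by simp)
        have d2 := (contDiff_rpow_mul (s - 1) hξ hH).differentiable (by simp)
        have hadd : pd (ev n j) (ψ j) p = pd (ev n j) (fun z => z.2 ^ s * pd (ev n j) ξ z) p +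
            (-s * (ev n j).2) * pd (ev n j) (fun z => z.2 ^ (s - 1) * ξ z) p := by
          have := pd_const_mul (f := fun z => z.2 ^ (s - 1) * ξ z) (-s * (ev n j).2) (ev n j) p
          simp only [pd] at this ⊢
          rw [← this, hψdef, fderiv_fun_add (d1 p) ((d2 p).const_mul _)]
          rfl
        rw [hadd, pd_rpow_mul _ hp0 ((contDiff_pd hξ _).differentiable (by simp) p),
          pd_rpow_mul _ hp0 (hξ.differentiable (by simp) p), show s - 1 - 1 = s - 2 by ring]
        linear_combination (-(s * (s - 1) * p.2 ^ (s - 2) * ξ p * V p)) * ev_snd_mul_self n j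
      simp only [this, Finset.sum_sub_distrib, sum_ev_snd, lap, Finset.sum_mul]
      congr 1
      exact Finset.sum_congr rfl fun j _ => by ring
    · have : ∀ j, pd (ev n j) (ψ j) p = 0 := fun j =>
        image_eq_zero_of_notMem_tsupport fun h => hp (hψs j (tsupport_pd_subset _ _ h))
      simp [this, hξ0 p hp, hlξ0 p hp]
  have i1 : Integrable fun p => lap (ev n) ξ p * (p.2 ^ s * V p) := by
    have := integrable_mul_of_eq_zero (μ := volume) hc
      (((hpc s).mul hVc).integrableOn_compact hc (f := fun p => p.2 ^ s * V p))
      (contDiff_lap hξ (ev n)).continuous hlξ0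
    refine this.congr (ae_of_all _ fun p => ?_)
    exact mul_comm _ _
  have i2 : Integrable fun p => ξ p * (s * (s - 1) * (p.2 ^ (s - 2) * V p)) := by
    have := integrable_mul_of_eq_zero (μ := volume) hc
      ((continuousOn_const.mul ((hpc (s - 2)).mul hVc)).integrableOn_compact hc
        (f := fun p => s * (s - 1) * (p.2 ^ (s - 2) * V p))) hξ.continuous hξ0
    refine this.congr (ae_of_all _ fun p => ?_)
    exact mul_comm _ _
  simp only [e2] at key
  rw [integral_sub i1 i2] at key
  linarith

/-- The mollification of `y ^ (a / 2) V` is a smooth subsolution up to mollification of the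
zeroth order term. -/
theorem WeakSub.lap_mol_ge {n : ℕ} {a s : ℝ} (hs : a = 2 * s) {V : Hn n → ℝ}
    (h : WeakSub n a V) {K : Set (Hn n)} (hK : IsCompact K) (hKH : K ⊆ {p | 0 < p.2})
    (hi : ∀ j, IntegrableOn (pd (ev n j) V) K) {φ : Hn n → ℝ} (hφ : ContDiff ℝ ∞ φ)
    (hc : HasCompactSupport φ) (h0 : ∀ p, 0 ≤ φ p) {x : Hn n}
    (hx : tsupport (fun z => φ (x - z)) ⊆ K) :
    mol volume φ (K.indicator fun p => s * (s - 1) * (p.2 ^ (s - 2) * V p)) x ≤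
      lap (ev n) (mol volume φ (K.indicator fun p => p.2 ^ s * V p)) x := by
  have hVc : ContinuousOn V K := fun p hp =>
    (h.differentiableAt p (hKH hp)).continuousAt.continuousWithinAt
  have hpc : ContinuousOn (fun p : Hn n => p.2 ^ s) K := fun p hp =>
    (contDiffAt_rpow_snd s (hKH hp)).continuousAt.continuousWithinAt
  have hvi : LocallyIntegrable (K.indicator fun p => p.2 ^ s * V p) volume :=
    (((hpc.mul hVc).integrableOn_compact hK).integrable_indicator
      hK.measurableSet).locallyIntegrable
  rw [lap_mol hφ hc hvi, mol_apply]
  have hξ : ContDiff ℝ ∞ (fun z => φ (x - z)) := hφ.comp (contDiff_const.sub contDiff_id)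
  have := h.integral_lap_ge hs hξ (hasCompactSupport_comp_sub_left hc x) (hx.trans hKH)
    (fun p => h0 _) fun j => (hi j).mono_set hx
  have aux : ∀ f g : Hn n → ℝ, (∀ z ∉ K, f z = 0) → ∀ z, f z * K.indicator g z = f z * g z := by
    intro f g hf z
    by_cases hz : z ∈ K
    · simp [hz]
    · simp [hf z hz]
  have z1 : ∀ z ∉ K, (fun z => φ (x - z)) z = 0 := fun z hz =>
    image_eq_zero_of_notMem_tsupport (f := fun z => φ (x - z)) fun h => hz (hx h)
  have z2 : ∀ z ∉ K, lap (ev n) (fun z => φ (x - z)) z = 0 := fun z hz =>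
    Finset.sum_eq_zero fun j _ => image_eq_zero_of_notMem_tsupport fun h => hz
      (hx (tsupport_pd_subset _ _ (tsupport_pd_subset _ _ h)))
  rw [integral_congr_ae (ae_of_all _ (aux _ _ z1)), integral_congr_ae (ae_of_all _ (aux _ _ z2))]
  exact this

/-- A sequence of bump functions at the origin with supports of radius `d / (i + 1)`. -/
def shrinkingBump (E : Type*) [NormedAddCommGroup E] [NormedSpace ℝ E] (d : ℝ) (hd : 0 < d)
    (i : ℕ) : ContDiffBump (0 : E) where
  rIn := d / (2 * (i + 1))
  rOut := d / (i + 1)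
  rIn_pos := by positivity
  rIn_lt_rOut := by
    have : (0 : ℝ) < i + 1 := by positivity
    exact div_lt_div_of_pos_left hd this (by linarith)

theorem rOut_shrinkingBump_le (E : Type*) [NormedAddCommGroup E] [NormedSpace ℝ E] {d : ℝ}
    (hd : 0 < d) (i : ℕ) : (shrinkingBump E d hd i).rOut ≤ d :=
  div_le_self hd.le (by linarith [(Nat.cast_nonneg i : (0 : ℝ) ≤ i)])

theorem tendsto_rOut_shrinkingBump (E : Type*) [NormedAddCommGroup E] [NormedSpace ℝ E] {d : ℝ}
    (hd : 0 < d) : Tendsto (fun i => (shrinkingBump E d hd i).rOut) atTop (𝓝 0) := by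
  have := (tendsto_one_div_add_atTop_nhds_zero_nat (𝕜 := ℝ)).const_mul d
  simpa [shrinkingBump, div_eq_mul_inv] using this

theorem tsupport_shrinkingBump_subset {n : ℕ} {d : ℝ} (hd : 0 < d) (i : ℕ) {x p : Hn n}
    (hp : p ∈ closedBall x d) :
    tsupport (fun z => (shrinkingBump (Hn n) d hd i).normed volume (p - z)) ⊆
      closedBall x (2 * d) := by
  refine (tsupport_comp_sub_left_subset (ε := d) ?_ p).trans ?_
  · rw [ContDiffBump.tsupport_normed_eq]
    exact closedBall_subset_closedBall (rOut_shrinkingBump_le _ hd i)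
  · refine closedBall_subset_closedBall' ?_
    have : dist p x ≤ d := hp
    linarith

theorem exists_rpow_bound {y₁ y₂ : ℝ} (hy : 0 < y₁) (r : ℝ) :
    ∃ A : ℝ, 0 ≤ A ∧ ∀ y ∈ Icc y₁ y₂, y ^ r ≤ A := by
  obtain ⟨A, hA⟩ := (isCompact_Icc (a := y₁) (b := y₂)).exists_bound_of_continuousOn
    (f := fun y => y ^ r) fun y hy' =>
      (Real.continuousAt_rpow_const y r (Or.inl (hy.trans_le hy'.1).ne')).continuousWithinAt
  exact ⟨|A|, abs_nonneg _, fun y hy' => (Real.le_norm_self _).trans ((hA y hy').trans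
    (le_abs_self A))⟩

/-- Scale invariant interior gradient estimate for weak subsolutions with integrable gradient. -/
theorem WeakSub.exists_lintegral_pd_le {n : ℕ} {a : ℝ} {V : Hn n → ℝ} (h : WeakSub n a V)
    {y₁ y₂ : ℝ} (hy : 0 < y₁) {k : ℝ} (hk : 0 ≤ k) :
    ∃ C : ℝ, ∀ (x : Hn n) (d c : ℝ), 0 < d → d ≤ 1 →
      closedBall x (2 * d) ⊆ {p | p.2 ∈ Icc y₁ y₂} →
      (∀ j, IntegrableOn (pd (ev n j) V) (closedBall x (2 * d))) →
      (∀ z ∈ closedBall x (2 * d), |V z - c| ≤ k * d) →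
      ∀ j, ∫⁻ z in closedBall x (d / 2), ‖pd (ev n j) V z‖ₑ ≤
        ENNReal.ofReal C * volume (closedBall x d) := by
  obtain ⟨s, hs⟩ : ∃ s, a = 2 * s := ⟨a / 2, by ring⟩
  obtain ⟨A₁, hA₁, hb₁⟩ := exists_rpow_bound (y₂ := y₂) hy s
  obtain ⟨A₂, hA₂, hb₂⟩ := exists_rpow_bound (y₂ := y₂) hy (s - 2)
  obtain ⟨A₃, hA₃, hb₃⟩ := exists_rpow_bound (y₂ := y₂) hy (-s)
  obtain ⟨A₄, hA₄, hb₄⟩ := exists_rpow_bound (y₂ := y₂) hy (s - 1)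
  obtain ⟨C₀, hC₀⟩ := exists_lintegral_enorm_pd_le (μ := (volume : Measure (Hn n))) (ev n)
  set B₂ := |s * (s - 1)| * A₂ with hB₂
  set B₄ := |s| * A₄ with hB₄
  set C₁ := 1 + (2 * C₀ * (A₁ * k) ^ 2 + 2 * (B₂ * k) * (A₁ * k)) with hC₁
  refine ⟨A₃ * (max C₁ 0 + B₄ * k), fun x d c hd hd1 hsub hint hosc j => ?_⟩
  set u : Hn n → ℝ := fun p => V p - c with hu
  have hus : WeakSub n a u := h.sub_const c
  have hpdu : ∀ j, pd (ev n j) u = pd (ev n j) V := fun j => by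
    ext p
    simp only [pd, hu, fderiv_sub_const]
  set K := closedBall x (2 * d) with hKdef
  have hK : IsCompact K := isCompact_closedBall _ _
  have hKH : K ⊆ {p : Hn n | 0 < p.2} := fun p hp => hy.trans_le (hsub hp).1
  have hkd : 0 ≤ k * d := mul_nonneg hk hd.le
  have huc : ContinuousOn u K := fun p hp =>
    (hus.differentiableAt p (hKH hp)).continuousAt.continuousWithinAt
  have hpc : ∀ r : ℝ, ContinuousOn (fun p : Hn n => p.2 ^ r) K := fun r p hp =>
    (contDiffAt_rpow_snd r (hKH hp)).continuousAt.continuousWithinAt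
  set v : Hn n → ℝ := fun p => p.2 ^ s * u p with hv
  set g : Hn n → ℝ := fun p => s * (s - 1) * (p.2 ^ (s - 2) * u p) with hg
  have hvd : ∀ p ∈ K, DifferentiableAt ℝ v p := fun p hp =>
    ((contDiffAt_rpow_snd s (hKH hp)).differentiableAt (by simp)).mul
      (hus.differentiableAt p (hKH hp))
  have hvb : ∀ p ∈ K, |v p| ≤ A₁ * (k * d) := fun p hp => by
    rw [hv, abs_mul, abs_of_nonneg (Real.rpow_nonneg (le_of_lt (hKH hp)) _)]
    exact mul_le_mul (hb₁ _ (hsub hp)) (hosc p hp) (abs_nonneg _) hA₁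
  have hgb : ∀ p ∈ K, |g p| ≤ B₂ * (k * d) := fun p hp => by
    rw [hg, abs_mul, abs_mul (p.2 ^ (s - 2)),
      abs_of_nonneg (Real.rpow_nonneg (le_of_lt (hKH hp)) (s - 2)), hB₂, mul_assoc]
    exact mul_le_mul_of_nonneg_left (mul_le_mul (hb₂ _ (hsub hp)) (hosc p hp) (abs_nonneg _) hA₂)
      (abs_nonneg _)
  have hpdv : ∀ p ∈ K, ∀ j, pd (ev n j) v p =
      p.2 ^ s * pd (ev n j) V p + s * (ev n j).2 * (p.2 ^ (s - 1) * u p) := fun p hp j => by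
    rw [hv, pd_rpow_mul s (hKH hp) (hus.differentiableAt p (hKH hp)), hpdu]
  have hpdvi : IntegrableOn (pd (ev n j) v) K := by
    refine IntegrableOn.congr_fun (f := fun p =>
      p.2 ^ s * pd (ev n j) V p + s * (ev n j).2 * (p.2 ^ (s - 1) * u p)) ?_
      (fun p hp => (hpdv p hp j).symm) hK.measurableSet
    refine ((hint j).continuousOn_mul (hpc s) hK).add ?_
    exact (continuousOn_const.mul ((hpc (s - 1)).mul huc)).integrableOn_compact hK
  have hvi : LocallyIntegrable (K.indicator v) volume :=
    ((((hpc s).mul huc).integrableOn_compact hK).integrable_indicator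
      hK.measurableSet).locallyIntegrable
  have hgi : LocallyIntegrable (K.indicator g) volume :=
    (((continuousOn_const.mul ((hpc (s - 2)).mul huc)).integrableOn_compact hK
      (f := g)).integrable_indicator hK.measurableSet).locallyIntegrable
  have hdvi : LocallyIntegrable (K.indicator (pd (ev n j) v)) volume :=
    (hpdvi.integrable_indicator hK.measurableSet).locallyIntegrable
  set φ : ℕ → Hn n → ℝ := fun i => (shrinkingBump (Hn n) d hd i).normed volume with hφdef
  have hφ : ∀ i, ContDiff ℝ ∞ (φ i) := fun i => ContDiffBump.contDiff_normed _
  have hφc : ∀ i, HasCompactSupport (φ i) := fun i => ContDiffBump.hasCompactSupport_normed _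
  have hφ0 : ∀ i p, 0 ≤ φ i p := fun i p => ContDiffBump.nonneg_normed _ p
  have hφ1 : ∀ i, ∫ p, φ i p = 1 := fun i => ContDiffBump.integral_normed _
  have hφK : ∀ i, ∀ p ∈ closedBall x d, tsupport (fun z => φ i (p - z)) ⊆ K := fun i p hp =>
    tsupport_shrinkingBump_subset hd i hp
  have hind : ∀ f : Hn n → ℝ, ∀ B : ℝ, 0 ≤ B → (∀ p ∈ K, |f p| ≤ B) → ∀ p,
      |K.indicator f p| ≤ B := by
    intro f B hB hf p
    by_cases hp : p ∈ K
    · simpa [hp] using hf p hp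
    · simpa [hp] using hB
  have hvb' := hind v _ (by positivity) hvb
  have hgb' := hind g _ (by positivity) hgb
  have hwi : ∀ i, ∫⁻ p in closedBall x (d / 2), ‖pd (ev n j) (mol volume (φ i) (K.indicator v)) p‖ₑ
      ≤ ENNReal.ofReal (max C₁ 0) * volume (closedBall x d) := by
    intro i
    refine (hC₀ _ x d (A₁ * (k * d)) (B₂ * (k * d)) (contDiff_mol (hφ i) (hφc i) hvi) hd
      (by positivity) (by positivity) (fun p _ => ?_) (fun p hp => ?_) j).trans ?_
    · exact abs_le.2 ⟨le_mol (hφ i) (hφc i) (hφ0 i) (hφ1 i) hvi fun z _ => (abs_le.1 (hvb' z)).1,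
        mol_le (hφ i) (hφc i) (hφ0 i) (hφ1 i) hvi fun z _ => (abs_le.1 (hvb' z)).2⟩
    · refine le_trans ?_ (hus.lap_mol_ge hs hK hKH (fun j => by rw [hpdu]; exact hint j) (hφ i)
        (hφc i) (hφ0 i) (hφK i p hp))
      exact le_mol (hφ i) (hφc i) (hφ0 i) (hφ1 i) hgi fun z _ => (abs_le.1 (hgb' z)).1
    · gcongr
      refine le_max_of_le_left ?_
      have e1 : A₁ * (k * d) / d = A₁ * k := by field_simp
      have e2 : 2 * (B₂ * (k * d)) * (A₁ * (k * d)) ≤ 2 * (B₂ * k) * (A₁ * k) := by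
        have : 0 ≤ 2 * (B₂ * k) * (A₁ * k) := by positivity
        have hd2 : d ^ 2 ≤ 1 := by nlinarith
        calc _ = 2 * (B₂ * k) * (A₁ * k) * d ^ 2 := by ring
          _ ≤ _ := by nlinarith
      rw [e1]
      linarith
  have hae := ContDiffBump.ae_convolution_tendsto_right_of_locallyIntegrable (K := 2)
    (tendsto_rOut_shrinkingBump (Hn n) hd) (Eventually.of_forall fun i => by
      simp only [shrinkingBump]
      have : (0 : ℝ) < i + 1 := by positivity
      apply le_of_eq
      field_simp) hdvi
  have hfatou : ∫⁻ p in closedBall x (d / 2), ‖pd (ev n j) v p‖ₑ ≤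
      ENNReal.ofReal (max C₁ 0) * volume (closedBall x d) := by
    calc _ ≤ ∫⁻ p in closedBall x (d / 2), liminf (fun i =>
          ‖pd (ev n j) (mol volume (φ i) (K.indicator v)) p‖ₑ) atTop := by
          refine lintegral_mono_ae ((ae_restrict_iff' measurableSet_closedBall).2 ?_)
          filter_upwards [hae] with p hp hpx
          have hpd : p ∈ closedBall x d := closedBall_subset_closedBall (by linarith) hpx
          have hpK : p ∈ K := closedBall_subset_closedBall (by linarith) hpd
          have ht : Tendsto (fun i => pd (ev n j) (mol volume (φ i) (K.indicator v)) p) atTop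
              (𝓝 (pd (ev n j) v p)) := by
            rw [indicator_of_mem hpK] at hp
            refine hp.congr fun i => ?_
            exact (pd_mol_indicator (hφ i) (hφc i) hK hvd (ev n j) hpdvi (hφK i p hpd)).symm
          exact ht.enorm.liminf_eq.ge
      _ ≤ liminf (fun i => ∫⁻ p in closedBall x (d / 2),
          ‖pd (ev n j) (mol volume (φ i) (K.indicator v)) p‖ₑ) atTop :=
          lintegral_liminf_le fun i =>
            (measurable_fderiv_apply_const ℝ (mol volume (φ i) (K.indicator v)) (ev n j)).enorm
      _ ≤ _ := by
          refine liminf_le_of_le (by isBoundedDefault) fun b hb => ?_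
          obtain ⟨i, hi⟩ := hb.exists
          exact hi.trans (hwi i)
  have hpt : ∀ p ∈ closedBall x (d / 2), ‖pd (ev n j) V p‖ₑ ≤
      ENNReal.ofReal A₃ * (‖pd (ev n j) v p‖ₑ + ENNReal.ofReal (B₄ * k)) := by
    intro p hp
    have hpK : p ∈ K := closedBall_subset_closedBall (by linarith) hp
    have hp0 : 0 < p.2 := hKH hpK
    have e1 : pd (ev n j) V p = p.2 ^ (-s) * (pd (ev n j) v p -
        s * (ev n j).2 * (p.2 ^ (s - 1) * u p)) := by
      have : p.2 ^ (-s) * p.2 ^ s = 1 := by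
        rw [← Real.rpow_add hp0, neg_add_cancel, Real.rpow_zero]
      rw [hpdv p hpK j]
      linear_combination (- pd (ev n j) V p) * this
    have e2 : |s * (ev n j).2 * (p.2 ^ (s - 1) * u p)| ≤ B₄ * k := by
      have t1 : |(ev n j).2| ≤ 1 := (norm_snd_le _).trans (norm_ev_le n j)
      rw [abs_mul, abs_mul, abs_mul, abs_of_nonneg (Real.rpow_nonneg hp0.le (s - 1))]
      have t2 : |u p| ≤ k := (hosc p hpK).trans (by nlinarith)
      calc |s| * |(ev n j).2| * (p.2 ^ (s - 1) * |u p|) ≤ |s| * 1 * (A₄ * k) := by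
            gcongr
            exact hb₄ _ (hsub hpK)
        _ = _ := by rw [hB₄]; ring
    rw [Real.enorm_eq_ofReal_abs, Real.enorm_eq_ofReal_abs,
      ← ENNReal.ofReal_add (abs_nonneg _) (by positivity), ← ENNReal.ofReal_mul hA₃, e1, abs_mul,
      abs_of_nonneg (Real.rpow_nonneg hp0.le _)]
    refine ENNReal.ofReal_le_ofReal (mul_le_mul (hb₃ _ (hsub hpK)) ?_ (abs_nonneg _) hA₃)
    exact (abs_sub _ _).trans (by linarith)
  calc _ ≤ ∫⁻ p in closedBall x (d / 2),
        ENNReal.ofReal A₃ * (‖pd (ev n j) v p‖ₑ + ENNReal.ofReal (B₄ * k)) :=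
        setLIntegral_mono' measurableSet_closedBall hpt
    _ = ENNReal.ofReal A₃ * ((∫⁻ p in closedBall x (d / 2), ‖pd (ev n j) v p‖ₑ) +
        ENNReal.ofReal (B₄ * k) * volume (closedBall x (d / 2))) := by
        rw [lintegral_const_mul' _ _ ENNReal.ofReal_ne_top, lintegral_add_right _ measurable_const]
        simp
    _ ≤ ENNReal.ofReal A₃ * (ENNReal.ofReal (max C₁ 0) * volume (closedBall x d) +
        ENNReal.ofReal (B₄ * k) * volume (closedBall x d)) := by
        gcongr
        linarith
    _ = _ := by
        rw [ENNReal.ofReal_mul hA₃, ENNReal.ofReal_add (le_max_right _ _) (by positivity)]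
        ring

/-- A Vitali covering argument: local integral bounds on concentric balls add up. -/
theorem setLIntegral_le_of_forall_closedBall {E : Type*} [NormedAddCommGroup E] [NormedSpace ℝ E]
    [FiniteDimensional ℝ E] [MeasurableSpace E] [BorelSpace E] (μ : Measure E)
    [μ.IsAddHaarMeasure] {f : E → ENNReal} {U B : Set E} {d : E → ℝ} {d₀ : ℝ} {C : ENNReal}
    (hd : ∀ x ∈ U, 0 < d x) (hd₀ : ∀ x ∈ U, d x ≤ d₀) (hB : ∀ x ∈ U, closedBall x (d x) ⊆ B)
    (hf : ∀ x ∈ U, ∫⁻ z in closedBall x (d x / 2), f z ∂μ ≤ C * μ (closedBall x (d x))) :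
    ∫⁻ z in U, f z ∂μ ≤ C * ENNReal.ofReal (10 ^ Module.finrank ℝ E) * μ B := by
  obtain ⟨u, huU, hdisj, hcov⟩ := Vitali.exists_disjoint_subfamily_covering_enlargement_closedBall
    U (fun x => x) (fun x => d x / 10) (d₀ / 10)
    (fun x hx => div_le_div_of_nonneg_right (hd₀ x hx) (by norm_num)) 5 (by norm_num)
  have hu : u.Countable := hdisj.countable_of_nonempty_interior fun x hx => by
    refine ⟨x, ball_subset_interior_closedBall (mem_ball_self ?_)⟩
    have := hd x (huU hx)
    positivity
  have hcov' : U ⊆ ⋃ x ∈ u, closedBall x (d x / 2) := fun x hx => by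
    obtain ⟨b, hb, hsub⟩ := hcov x hx
    refine mem_biUnion hb ?_
    have := hsub (mem_closedBall_self (by have := hd x hx; positivity))
    rwa [show 5 * (d b / 10) = d b / 2 by ring] at this
  have hscale : ∀ x ∈ u, μ (closedBall x (d x)) =
      ENNReal.ofReal (10 ^ Module.finrank ℝ E) * μ (closedBall x (d x / 10)) := fun x hx => by
    have h0 := hd x (huU hx)
    rw [Measure.addHaar_closedBall μ x h0.le, Measure.addHaar_closedBall μ x (by positivity),
      ← mul_assoc, ← ENNReal.ofReal_mul (by positivity), ← mul_pow]
    congr 4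
    ring
  have := hu.to_subtype
  calc ∫⁻ z in U, f z ∂μ ≤ ∫⁻ z in ⋃ x ∈ u, closedBall x (d x / 2), f z ∂μ :=
        lintegral_mono_set hcov'
    _ = ∫⁻ z in ⋃ x : u, closedBall (x : E) (d x / 2), f z ∂μ := by rw [biUnion_eq_iUnion]
    _ ≤ ∑' x : u, ∫⁻ z in closedBall (x : E) (d x / 2), f z ∂μ := lintegral_iUnion_le _ _
    _ ≤ ∑' x : u, C * ENNReal.ofReal (10 ^ Module.finrank ℝ E) *
          μ (closedBall (x : E) (d x / 10)) := by
        refine ENNReal.tsum_le_tsum fun x => (hf x (huU x.2)).trans ?_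
        rw [hscale x x.2, mul_assoc]
    _ = C * ENNReal.ofReal (10 ^ Module.finrank ℝ E) *
          μ (⋃ x ∈ u, closedBall (x : E) (d x / 10)) := by
        rw [ENNReal.tsum_mul_left, measure_biUnion hu hdisj fun x _ => measurableSet_closedBall]
    _ ≤ _ := by
        gcongr
        refine iUnion₂_subset fun x hx => ?_
        refine (closedBall_subset_closedBall ?_).trans (hB x (huU hx))
        linarith [hd x (huU hx)]

theorem isOpen_setOf_integrableAtFilter {X F : Type*} [TopologicalSpace X] [MeasurableSpace X]
    [NormedAddCommGroup F] (f : X → F) (μ : Measure X) :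
    IsOpen {x | IntegrableAtFilter f (𝓝 x) μ} := by
  refine isOpen_iff_mem_nhds.2 fun x hx => ?_
  obtain ⟨u, hu, hfu⟩ := hx
  filter_upwards [eventually_mem_nhds_iff.2 hu] with y hy using ⟨u, hy, hfu⟩

/-- If `V` is pointwise differentiable, then near some point of a nonempty locally closed set `S`
the difference quotients at points of `S` are uniformly bounded (Baire category theorem). -/
theorem exists_uniform_lipschitz_portion {E : Type*} [NormedAddCommGroup E] [NormedSpace ℝ E]
    [FiniteDimensional ℝ E] {V : E → ℝ} {S : Set E} (hS : IsLocallyClosed S) (hne : S.Nonempty)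
    (hV : ∀ p ∈ S, DifferentiableAt ℝ V p) :
    ∃ p₀ ∈ S, ∃ δ > 0, ∃ k : ℝ, 0 ≤ k ∧ ∀ p ∈ S, dist p p₀ < δ → ∀ q, dist q p < δ →
      |V q - V p| ≤ k * dist q p := by
  have := FiniteDimensional.proper_real E
  have := hS.locallyCompactSpace
  have := hne.to_subtype
  set F : ℕ → Set S := fun k => {p | ∀ q : E, dist q p < 1 / ((k : ℝ) + 1) →
    |V q - V p| ≤ k * dist q p}
  have hVc : Continuous fun p : S => V p := continuous_iff_continuousAt.2 fun p =>
    (hV p p.2).continuousAt.comp continuous_subtype_val.continuousAt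
  have hF : ∀ k, IsClosed (F k) := fun k => by
    simp only [F, ofPred_forall]
    refine isClosed_iInter fun q => isClosed_imp ?_ ?_
    · exact isOpen_lt (by fun_prop) (by fun_prop)
    · exact isClosed_le (continuous_const.sub hVc).abs (by fun_prop)
  have hU : ⋃ k, F k = univ := by
    refine eq_univ_of_forall fun p => ?_
    obtain ⟨c, hc⟩ := (hV p p.2).isBigO_sub.bound
    obtain ⟨ε, hε, hb⟩ := Metric.eventually_nhds_iff.1 hc
    obtain ⟨k₁, hk₁⟩ := exists_nat_one_div_lt hε
    obtain ⟨k₂, hk₂⟩ := exists_nat_ge c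
    refine mem_iUnion.2 ⟨max k₁ k₂, fun q hq => ?_⟩
    have h1 : 1 / (((max k₁ k₂ : ℕ) : ℝ) + 1) ≤ 1 / ((k₁ : ℝ) + 1) := by
      gcongr
      exact le_max_left _ _
    have h2 : (k₂ : ℝ) ≤ (max k₁ k₂ : ℕ) := by exact_mod_cast le_max_right _ _
    have := hb (hq.trans_le (h1.trans hk₁.le))
    rw [Real.norm_eq_abs, ← dist_eq_norm] at this
    exact this.trans (mul_le_mul_of_nonneg_right (hk₂.trans h2) dist_nonneg)
  obtain ⟨k, p₀, hp₀⟩ := nonempty_interior_of_iUnion_of_closed hF hU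
  obtain ⟨δ, hδ, hsub⟩ := Metric.mem_nhds_iff.1 (mem_interior_iff_mem_nhds.1 hp₀)
  refine ⟨p₀, p₀.2, min δ (1 / ((k : ℝ) + 1)), by positivity, k, by positivity, fun p hp hpd q hq =>
    ?_⟩
  have : (⟨p, hp⟩ : S) ∈ F k := hsub (hpd.trans_le (min_le_left _ _))
  exact this q (hq.trans_le (min_le_right _ _))

/-- The gradient of a weak subsolution is locally integrable. -/
theorem WeakSub.integrableAtFilter_pd {n : ℕ} {a : ℝ} {V : Hn n → ℝ} (h : WeakSub n a V)
    {p : Hn n} (hp : 0 < p.2) (j : Option (Fin n)) :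
    IntegrableAtFilter (pd (ev n j) V) (𝓝 p) := by
  set G : Set (Hn n) := ⋂ j, {p | IntegrableAtFilter (pd (ev n j) V) (𝓝 p)} with hG
  have hGo : IsOpen G := isOpen_iInter_of_finite fun j => isOpen_setOf_integrableAtFilter _ _
  set S : Set (Hn n) := {p | 0 < p.2} ∩ Gᶜ with hSdef
  have hS : IsLocallyClosed S := (isOpen_upper n).isLocallyClosed.inter
    hGo.isClosed_compl.isLocallyClosed
  suffices hSe : S = ∅ by
    by_contra hcon
    have : p ∈ S := ⟨hp, fun hpG => hcon (mem_iInter.1 hpG j)⟩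
    rw [hSe] at this
    exact this
  by_contra hne
  obtain ⟨p₀, hp₀, δ, hδ, k, hk, hlip⟩ := exists_uniform_lipschitz_portion hS
    (nonempty_iff_ne_empty.2 hne) fun p hp => h.differentiableAt p hp.1
  have hp₀2 : 0 < p₀.2 := hp₀.1
  set ρ := min (min δ 1) p₀.2 / 8 with hρ
  have hρ0 : 0 < ρ := by positivity
  have hρδ : 8 * ρ ≤ δ := by
    have : min (min δ 1) p₀.2 ≤ δ := (min_le_left _ _).trans (min_le_left _ _)
    linarith
  have hρ1 : 8 * ρ ≤ 1 := by
    have : min (min δ 1) p₀.2 ≤ 1 := (min_le_left _ _).trans (min_le_right _ _)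
    linarith
  have hρy : 8 * ρ ≤ p₀.2 := by
    have : min (min δ 1) p₀.2 ≤ p₀.2 := min_le_right _ _
    linarith
  obtain ⟨C, hC⟩ := h.exists_lintegral_pd_le (y₁ := p₀.2 / 2) (y₂ := 2 * p₀.2) (half_pos hp₀2)
    (k := 10 * k) (by positivity)
  have hbox : closedBall p₀ (2 * ρ) ⊆ {p | p.2 ∈ Icc (p₀.2 / 2) (2 * p₀.2)} := fun z hz => by
    have h1 : |z.2 - p₀.2| ≤ 2 * ρ := (norm_snd_le (z - p₀)).trans (by
      rwa [← dist_eq_norm])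
    have := abs_le.1 h1
    constructor <;> linarith
  set d : Hn n → ℝ := fun x => infDist x S / 4 with hddef
  set U := ball p₀ ρ \ S with hU
  have hball2 : ball p₀ ρ ⊆ closedBall p₀ (2 * ρ) := fun z hz => by
    have : dist z p₀ < ρ := hz
    exact mem_closedBall.2 (by linarith)
  have hd0 : ∀ x ∈ U, 0 < d x := fun x hx => by
    have hxH : 0 < x.2 := (half_pos hp₀2).trans_le (hbox (hball2 hx.1)).1
    have hxG : x ∈ {p : Hn n | 0 < p.2} ∩ G := ⟨hxH, by
      by_contra hxG
      exact hx.2 ⟨hxH, hxG⟩⟩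
    have hopen : IsOpen ({p : Hn n | 0 < p.2} ∩ G) := (isOpen_upper n).inter hGo
    have : x ∉ closure S := fun hxc => by
      obtain ⟨z, hz, hzS⟩ := mem_closure_iff.1 hxc _ hopen hxG
      exact hzS.2 hz.2
    have := (infDist_pos_iff_notMem_closure ⟨p₀, hp₀⟩).1 this
    simp only [hddef]
    positivity
  have hdρ : ∀ x ∈ U, 4 * d x < ρ := fun x hx => by
    have : infDist x S ≤ dist x p₀ := infDist_le_dist_of_mem hp₀
    have h2 : dist x p₀ < ρ := hx.1
    simp only [hddef]
    linarith
  have hsub : ∀ x ∈ U, closedBall x (2 * d x) ⊆ closedBall p₀ (2 * ρ) := fun x hx => by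
    refine closedBall_subset_closedBall' ?_
    have h2 : dist x p₀ < ρ := hx.1
    linarith [hdρ x hx, hd0 x hx]
  have hmain : ∀ j, ∫⁻ z in U, ‖pd (ev n j) V z‖ₑ < ⊤ := fun j => by
    refine (setLIntegral_le_of_forall_closedBall volume (d := d) (d₀ := ρ)
      (B := closedBall p₀ (2 * ρ)) (C := ENNReal.ofReal C) hd0
      (fun x hx => by linarith [hdρ x hx, hd0 x hx])
      (fun x hx => (closedBall_subset_closedBall (by linarith [hd0 x hx])).trans (hsub x hx))
      fun x hx => ?_).trans_lt ?_
    · have hdx := hd0 x hx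
      have hdx' := hdρ x hx
      obtain ⟨q, hqS, hq⟩ := (infDist_lt_iff ⟨p₀, hp₀⟩ (x := x) (r := 8 * d x)).1 (by
        simp only [hddef] at hdx ⊢
        linarith)
      have hx0 : dist x p₀ < ρ := hx.1
      refine hC x (d x) (V q) hdx (by linarith) ((hsub x hx).trans hbox) (fun j => ?_)
        (fun z hz => ?_) j
      · refine LocallyIntegrableOn.integrableOn_isCompact (fun z hz => ?_)
          (isCompact_closedBall _ _)
        have hzS : z ∉ S := fun hzS => by
          have h1 : infDist x S ≤ dist x z := infDist_le_dist_of_mem hzS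
          have h2 : dist z x ≤ 2 * d x := hz
          rw [dist_comm] at h2
          simp only [hddef] at hdx h2
          linarith
        have hzG : z ∈ G := by
          by_contra hzG
          exact hzS ⟨(half_pos hp₀2).trans_le (hbox (hsub x hx hz)).1, hzG⟩
        exact (mem_iInter.1 hzG j).filter_mono nhdsWithin_le_nhds
      · have h2 : dist z x ≤ 2 * d x := hz
        have hzq : dist z q ≤ 10 * d x := by linarith [dist_triangle z x q]
        have hqp : dist q p₀ < δ := by
          have := dist_triangle q x p₀
          rw [dist_comm q x] at this
          linarith
        refine (hlip q hqS hqp z (by linarith)).trans ?_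
        rw [mul_comm 10 k, mul_assoc]
        exact mul_le_mul_of_nonneg_left hzq hk
    · exact ENNReal.mul_lt_top (ENNReal.mul_lt_top ENNReal.ofReal_lt_top ENNReal.ofReal_lt_top)
        measure_closedBall_lt_top
  refine hp₀.2 (mem_iInter.2 fun j => ⟨ball p₀ ρ, ball_mem_nhds _ hρ0, ?_, ?_⟩)
  · exact (measurable_fderiv_apply_const ℝ V (ev n j)).aestronglyMeasurable
  · have hSb : ∀ z ∈ S ∩ ball p₀ ρ, ‖pd (ev n j) V z‖ₑ ≤ ENNReal.ofReal k := fun z hz => by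
      have hz2 : dist z p₀ < ρ := hz.2
      have h1 : ‖fderiv ℝ V z‖ ≤ k := norm_fderiv_le_of_lip' ℝ hk (by
        filter_upwards [ball_mem_nhds z hδ] with q hq
        have := hlip z hz.1 (by linarith) q hq
        rwa [dist_eq_norm] at this)
      rw [← ofReal_norm]
      refine ENNReal.ofReal_le_ofReal (((fderiv ℝ V z).le_opNorm _).trans ?_)
      nlinarith [norm_ev_le n j, norm_nonneg (ev n j), norm_nonneg (fderiv ℝ V z)]
    have hcov : ball p₀ ρ = U ∪ (S ∩ ball p₀ ρ) := by
      rw [inter_comm, hU, sdiff_union_inter]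
    have hSm : MeasurableSet (S ∩ ball p₀ ρ) :=
      (((isOpen_upper n).measurableSet).inter hGo.measurableSet.compl).inter measurableSet_ball
    rw [HasFiniteIntegral, hcov]
    refine (lintegral_union_le _ _ _).trans_lt (ENNReal.add_lt_top.2 ⟨hmain j, ?_⟩)
    refine (setLIntegral_mono' hSm hSb).trans_lt ?_
    rw [setLIntegral_const]
    exact ENNReal.mul_lt_top ENNReal.ofReal_lt_top
      ((measure_mono inter_subset_right).trans_lt measure_ball_lt_top)

theorem WeakSub.integrableOn_pd {n : ℕ} {a : ℝ} {V : Hn n → ℝ} (h : WeakSub n a V)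
    {K : Set (Hn n)} (hK : IsCompact K) (hKH : K ⊆ {p | 0 < p.2}) (j : Option (Fin n)) :
    IntegrableOn (pd (ev n j) V) K :=
  LocallyIntegrableOn.integrableOn_isCompact
    (fun _ hp => (h.integrableAtFilter_pd (hKH hp) j).filter_mono nhdsWithin_le_nhds) hK

theorem contDiffAt_pd {E : Type*} [NormedAddCommGroup E] [NormedSpace ℝ E] {f : E → ℝ} {p : E}
    (hf : ContDiffAt ℝ ∞ f p) (e : E) : ContDiffAt ℝ ∞ (pd e f) p :=
  (hf.fderiv_right (m := ∞) (by simp)).clm_apply contDiffAt_const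

theorem ContDiffAt.eventually_differentiableAt {E : Type*} [NormedAddCommGroup E]
    [NormedSpace ℝ E] {f : E → ℝ} {p : E} (hf : ContDiffAt ℝ ∞ f p) :
    ∀ᶠ z in 𝓝 p, DifferentiableAt ℝ f z := by
  have h1 : ContDiffAt ℝ 1 f p := hf.of_le (by norm_cast)
  exact (h1.eventually (by simp)).mono fun z hz => hz.differentiableAt (by simp)

theorem continuousAt_lap {E ι : Type*} [Fintype ι] [NormedAddCommGroup E] [NormedSpace ℝ E]
    {f : E → ℝ} {p : E} (hf : ContDiffAt ℝ ∞ f p) (e : ι → E) : ContinuousAt (lap e f) p :=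
  tendsto_finsetSum _ fun i _ => (contDiffAt_pd (contDiffAt_pd hf (e i)) (e i)).continuousAt

theorem pd_congr {E : Type*} [NormedAddCommGroup E] [NormedSpace ℝ E] {f g : E → ℝ} {p : E}
    (h : f =ᶠ[𝓝 p] g) (e : E) : pd e f =ᶠ[𝓝 p] pd e g := by
  filter_upwards [h.eventuallyEq_nhds] with z hz
  simp only [pd, hz.fderiv_eq]

theorem pd_add {E : Type*} [NormedAddCommGroup E] [NormedSpace ℝ E] {f g : E → ℝ} {p : E}
    (hf : DifferentiableAt ℝ f p) (hg : DifferentiableAt ℝ g p) (e : E) :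
    pd e (fun z => f z + g z) p = pd e f p + pd e g p := by
  simp only [pd, fderiv_fun_add hf hg]
  rfl

theorem lap_add {E ι : Type*} [Fintype ι] [NormedAddCommGroup E] [NormedSpace ℝ E]
    {f g : E → ℝ} {p : E} (hf : ContDiffAt ℝ ∞ f p) (hg : ContDiffAt ℝ ∞ g p) (e : ι → E) :
    lap e (fun z => f z + g z) p = lap e f p + lap e g p := by
  simp only [lap, ← Finset.sum_add_distrib]
  refine Finset.sum_congr rfl fun i _ => ?_
  have h1 : pd (e i) (fun z => f z + g z) =ᶠ[𝓝 p] fun z => pd (e i) f z + pd (e i) g z := by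
    filter_upwards [hf.eventually_differentiableAt, hg.eventually_differentiableAt] with z h1 h2
      using pd_add h1 h2 _
  rw [(pd_congr h1 (e i)).eq_of_nhds,
    pd_add ((contDiffAt_pd hf _).differentiableAt (by simp))
      ((contDiffAt_pd hg _).differentiableAt (by simp))]

theorem lap_const_mul {E ι : Type*} [Fintype ι] [NormedAddCommGroup E] [NormedSpace ℝ E]
    {f : E → ℝ} (c : ℝ) (e : ι → E) (p : E) :
    lap e (fun z => c * f z) p = c * lap e f p := by
  simp only [lap, Finset.mul_sum]
  refine Finset.sum_congr rfl fun i _ => ?_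
  have : pd (e i) (fun z => c * f z) = fun z => c * pd (e i) f z := funext fun z =>
    pd_const_mul c _ _
  rw [this, pd_const_mul]

theorem IsLocalMax.pd_pd_nonpos {E : Type*} [NormedAddCommGroup E] [NormedSpace ℝ E] {f : E → ℝ}
    {p : E} (h : IsLocalMax f p) (hf : ContDiffAt ℝ ∞ f p) (e : E) : pd e (pd e f) p ≤ 0 := by
  by_contra! hpos
  set γ : ℝ → E := fun t => p + t • e with hγ
  have hγ0 : γ 0 = p := by simp [hγ]
  have hγd : ∀ t, HasDerivAt γ e t := fun t => by
    simpa [hγ] using ((hasDerivAt_id t).smul_const e).const_add p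
  have hγt : Tendsto γ (𝓝 0) (𝓝 p) := hγ0 ▸ (hγd 0).continuousAt.tendsto
  have hd : ∀ g : E → ℝ, ∀ t, DifferentiableAt ℝ g (γ t) →
      HasDerivAt (fun t => g (γ t)) (pd e g (γ t)) t := fun g t hg =>
    hg.hasFDerivAt.comp_hasDerivAt t (hγd t)
  have h1 : deriv (fun t => f (γ t)) =ᶠ[𝓝 0] fun t => pd e f (γ t) := by
    filter_upwards [hγt.eventually hf.eventually_differentiableAt] with t ht
    exact (hd f t ht).deriv
  have h2 : deriv (deriv fun t => f (γ t)) 0 = pd e (pd e f) p := by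
    rw [h1.deriv_eq, (hd _ 0 (hγ0.symm ▸ (contDiffAt_pd hf e).differentiableAt (by simp))).deriv,
      hγ0]
  have hmax : IsLocalMax (fun t => f (γ t)) 0 := by
    have := hγt.eventually h
    simpa only [IsLocalMax, IsMaxFilter, hγ0] using this
  have hmin : IsLocalMin (fun t => f (γ t)) 0 :=
    isLocalMin_of_deriv_deriv_pos (h2 ▸ hpos) hmax.deriv_eq_zero
      (hd f 0 (hγ0.symm ▸ hf.differentiableAt (by simp))).continuousAt
  have hconst : (fun t => f (γ t)) =ᶠ[𝓝 0] fun _ => f (γ 0) := by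
    filter_upwards [hmax, hmin] with t ht1 ht2 using le_antisymm ht1 ht2
  have h3 : deriv (deriv fun t => f (γ t)) 0 = 0 := by
    rw [hconst.deriv.deriv_eq]
    simp
  linarith

theorem IsLocalMax.lap_nonpos {E ι : Type*} [Fintype ι] [NormedAddCommGroup E] [NormedSpace ℝ E]
    {f : E → ℝ} {p : E} (h : IsLocalMax f p) (hf : ContDiffAt ℝ ∞ f p) (e : ι → E) :
    lap e f p ≤ 0 :=
  Finset.sum_nonpos fun i _ => h.pd_pd_nonpos hf (e i)

theorem pd_norm_fst_sub_sq {n : ℕ} (x₀ : En n) (e p : Hn n) :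
    pd e (fun z => ‖z.1 - x₀‖ ^ 2) p = 2 * inner ℝ (p.1 - x₀) e.1 := by
  have h : HasFDerivAt (fun z : Hn n => z.1 - x₀) (ContinuousLinearMap.fst ℝ (En n) ℝ) p :=
    hasFDerivAt_fst.sub_const x₀
  rw [pd, h.norm_sq.fderiv]
  simp [inner_sub_left]

theorem pd_inner_fst_sub {n : ℕ} (x₀ v : En n) (e p : Hn n) :
    pd e (fun z => inner ℝ (z.1 - x₀) v) p = inner ℝ e.1 v := by
  have h : HasFDerivAt (fun z : Hn n => z.1 - x₀) (ContinuousLinearMap.fst ℝ (En n) ℝ) p :=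
    hasFDerivAt_fst.sub_const x₀
  rw [pd, (h.inner ℝ (hasFDerivAt_const v p)).fderiv]
  simp

theorem lap_norm_fst_sub_sq {n : ℕ} (x₀ : En n) (p : Hn n) :
    lap (ev n) (fun z => ‖z.1 - x₀‖ ^ 2) p = 2 * n := by
  have : ∀ e : Hn n, pd e (pd e fun z => ‖z.1 - x₀‖ ^ 2) p = 2 * inner ℝ e.1 e.1 := fun e => by
    rw [funext (pd_norm_fst_sub_sq x₀ e), pd_const_mul, pd_inner_fst_sub]
  simp only [lap, this, Fintype.sum_option]
  simp [ev]
  ring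

theorem pd_snd {n : ℕ} (e p : Hn n) : pd e (fun z => z.2) p = e.2 := by
  rw [pd, (hasFDerivAt_snd (𝕜 := ℝ) (E := En n) (F := ℝ) (p := p)).fderiv]
  rfl

theorem lap_snd_sub_sq {n : ℕ} (y₀ : ℝ) (p : Hn n) :
    lap (ev n) (fun z => (z.2 - y₀) ^ 2) p = 2 := by
  have h1 : ∀ e : Hn n, pd e (fun z => (z.2 - y₀) ^ 2) = fun z => (2 * e.2) * (z.2 - y₀) := by
    intro e
    ext p
    have := ((hasFDerivAt_snd (𝕜 := ℝ) (E := En n) (F := ℝ) (p := p)).sub_const y₀).pow 2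
    rw [pd, this.fderiv]
    simp
    ring
  have h2 : ∀ e : Hn n, pd e (fun z => z.2 - y₀) p = e.2 := fun e => by
    simp only [pd, fderiv_sub_const]
    exact pd_snd e p
  simp only [lap, h1, pd_const_mul, h2, Fintype.sum_option]
  simp [ev]

/-- A smooth function touching `y ^ (a / 2) V` from above is a subsolution at the contact point. -/
theorem WeakSub.lap_ge_of_touching {n : ℕ} {a s : ℝ} (hs : a = 2 * s) {V : Hn n → ℝ}
    (h : WeakSub n a V) {Γ₀ : Hn n → ℝ} {p₀ : Hn n} (hp₀ : 0 < p₀.2)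
    (hΓ₀ : ∀ p : Hn n, 0 < p.2 → ContDiffAt ℝ ∞ Γ₀ p)
    (hle : ∀ᶠ p in 𝓝 p₀, p.2 ^ s * V p ≤ Γ₀ p) (heq : p₀.2 ^ s * V p₀ = Γ₀ p₀) :
    s * (s - 1) * (p₀.2 ^ (s - 2) * V p₀) ≤ lap (ev n) Γ₀ p₀ := by
  by_contra! hlt
  set g : Hn n → ℝ := fun p => s * (s - 1) * (p.2 ^ (s - 2) * V p) with hg
  set v : Hn n → ℝ := fun p => p.2 ^ s * V p with hv
  have hVc : ∀ p : Hn n, 0 < p.2 → ContinuousAt V p := fun p hp =>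
    (h.differentiableAt p hp).continuousAt
  have hpc : ∀ (r : ℝ) (p : Hn n), 0 < p.2 → ContinuousAt (fun p : Hn n => p.2 ^ r) p :=
    fun r p hp => (contDiffAt_rpow_snd r hp).continuousAt
  have hgc : ∀ p : Hn n, 0 < p.2 → ContinuousAt g p := fun p hp =>
    continuousAt_const.mul ((hpc _ p hp).mul (hVc p hp))
  have hvc : ∀ p : Hn n, 0 < p.2 → ContinuousAt v p := fun p hp => (hpc _ p hp).mul (hVc p hp)
  set Q : Hn n → ℝ := fun p => ‖p.1 - p₀.1‖ ^ 2 + (p.2 - p₀.2) ^ 2 with hQ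
  have hQ1 : ContDiff ℝ ∞ fun p : Hn n => ‖p.1 - p₀.1‖ ^ 2 :=
    (contDiff_fst.sub contDiff_const).norm_sq ℝ
  have hQ2 : ContDiff ℝ ∞ fun p : Hn n => (p.2 - p₀.2) ^ 2 :=
    (contDiff_snd.sub contDiff_const).pow 2
  have hQs : ContDiff ℝ ∞ Q := hQ1.add hQ2
  have hQl : lap (ev n) Q p₀ = 2 * n + 2 := by
    rw [hQ, lap_add hQ1.contDiffAt hQ2.contDiffAt, lap_norm_fst_sub_sq, lap_snd_sub_sq]
  have hQd : ∀ p, dist p p₀ ^ 2 ≤ Q p := fun p => by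
    rw [dist_eq_norm, Prod.norm_def, hQ]
    rcases max_choice ‖(p - p₀).1‖ ‖(p - p₀).2‖ with hm | hm <;> rw [hm]
    · simp [sq_nonneg]
    · simp
  set κ := (g p₀ - lap (ev n) Γ₀ p₀) / (4 * n + 4) with hκ
  have hκ0 : 0 < κ := div_pos (sub_pos.2 hlt) (by positivity)
  set Γ : Hn n → ℝ := fun p => Γ₀ p + κ * Q p with hΓ
  have hΓs : ∀ p : Hn n, 0 < p.2 → ContDiffAt ℝ ∞ Γ p := fun p hp =>
    (hΓ₀ p hp).add (contDiffAt_const.mul hQs.contDiffAt)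
  have hΓl : lap (ev n) Γ p₀ < g p₀ := by
    rw [hΓ, lap_add (hΓ₀ p₀ hp₀) (contDiffAt_const.mul hQs.contDiffAt), lap_const_mul, hQl]
    have : κ * (4 * n + 4) = g p₀ - lap (ev n) Γ₀ p₀ := by
      rw [hκ]
      field_simp
    linarith
  obtain ⟨τ, hτ1, hτ2⟩ := exists_between hΓl
  have hup : ∀ᶠ p : Hn n in 𝓝 p₀, 0 < p.2 := (isOpen_upper n).mem_nhds hp₀
  have hev : ∀ᶠ p in 𝓝 p₀, 0 < p.2 ∧ lap (ev n) Γ p < τ ∧ τ < g p ∧ v p ≤ Γ₀ p :=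
    hup.and
      (((continuousAt_lap (hΓs p₀ hp₀) _).eventually_lt_const hτ1).and
        (((hgc p₀ hp₀).eventually_const_lt hτ2).and hle))
  obtain ⟨R, hR, hball⟩ := Metric.eventually_nhds_iff.1 hev
  set r := R / 4 with hr
  have hr0 : 0 < r := by positivity
  set K := closedBall p₀ (2 * r) with hKdef
  have hK : IsCompact K := isCompact_closedBall _ _
  have hKp : ∀ p ∈ K, 0 < p.2 ∧ lap (ev n) Γ p < τ ∧ τ < g p ∧ v p ≤ Γ₀ p := fun p hp =>
    hball (lt_of_le_of_lt (mem_closedBall.1 hp) (by linarith))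
  have hKH : K ⊆ {p | 0 < p.2} := fun p hp => (hKp p hp).1
  have hvK : ContinuousOn v K := fun p hp => (hvc p (hKH hp)).continuousWithinAt
  have hgK : ContinuousOn g K := fun p hp => (hgc p (hKH hp)).continuousWithinAt
  have hvi : LocallyIntegrable (K.indicator v) volume :=
    ((hvK.integrableOn_compact hK).integrable_indicator hK.measurableSet).locallyIntegrable
  have hgi : LocallyIntegrable (K.indicator g) volume :=
    ((hgK.integrableOn_compact hK).integrable_indicator hK.measurableSet).locallyIntegrable
  set η := κ * r ^ 2 / 4 with hη
  have hη0 : 0 < η := by positivity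
  obtain ⟨δ, hδ, huc⟩ := Metric.uniformContinuousOn_iff.1
    (hK.uniformContinuousOn_of_continuous hvK) η hη0
  obtain ⟨i, hi⟩ := ((tendsto_rOut_shrinkingBump (Hn n) hr0).eventually_lt_const hδ).exists
  set φ : Hn n → ℝ := (shrinkingBump (Hn n) r hr0 i).normed volume with hφdef
  have hφ : ContDiff ℝ ∞ φ := ContDiffBump.contDiff_normed _
  have hφc : HasCompactSupport φ := ContDiffBump.hasCompactSupport_normed _
  have hφ0 : ∀ p, 0 ≤ φ p := fun p => ContDiffBump.nonneg_normed _ p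
  have hφ1 : ∫ p, φ p = 1 := ContDiffBump.integral_normed _
  have hφK : ∀ p ∈ closedBall p₀ r, tsupport (fun z => φ (p - z)) ⊆ K := fun p hp =>
    tsupport_shrinkingBump_subset hr0 i hp
  have hφz : ∀ p ∈ closedBall p₀ r, ∀ z, φ (p - z) ≠ 0 → z ∈ K ∧ dist p z < δ := by
    intro p hp z hz
    refine ⟨hφK p hp (subset_tsupport _ hz), ?_⟩
    have : p - z ∈ Function.support φ := hz
    rw [hφdef, ContDiffBump.support_normed_eq, mem_ball_zero_iff, ← dist_eq_norm] at this
    exact this.trans hi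
  set w := mol volume φ (K.indicator v) with hw
  have hws : ContDiff ℝ ∞ w := contDiff_mol hφ hφc hvi
  have hrK : closedBall p₀ r ⊆ K := closedBall_subset_closedBall (by linarith)
  have hwl : ∀ p ∈ closedBall p₀ r, τ ≤ lap (ev n) w p := fun p hp => by
    refine le_trans ?_ (h.lap_mol_ge hs hK hKH (fun j => h.integrableOn_pd hK hKH j) hφ hφc hφ0
      (hφK p hp))
    refine le_mol hφ hφc hφ0 hφ1 hgi fun z hz => ?_
    rw [indicator_of_mem (hφz p hp z hz).1]
    exact (hKp z (hφz p hp z hz).1).2.2.1.le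
  have hwv : ∀ p ∈ closedBall p₀ r, v p - η ≤ w p ∧ w p ≤ v p + η := fun p hp => by
    have hvz : ∀ z, φ (p - z) ≠ 0 → |v p - K.indicator v z| < η := fun z hz => by
      rw [indicator_of_mem (hφz p hp z hz).1, ← Real.dist_eq]
      exact huc p (hrK hp) z (hφz p hp z hz).1 (hφz p hp z hz).2
    exact ⟨le_mol hφ hφc hφ0 hφ1 hvi fun z hz => by linarith [(abs_lt.1 (hvz z hz)).2],
      mol_le hφ hφc hφ0 hφ1 hvi fun z hz => by linarith [(abs_lt.1 (hvz z hz)).1]⟩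
  set f : Hn n → ℝ := fun p => w p + (-1) * Γ p with hf
  have hfs : ∀ p ∈ closedBall p₀ r, ContDiffAt ℝ ∞ f p := fun p hp =>
    hws.contDiffAt.add (contDiffAt_const.mul (hΓs p (hKH (hrK hp))))
  obtain ⟨P, hP, hmax⟩ := (isCompact_closedBall p₀ r).exists_isMaxOn
    ⟨p₀, mem_closedBall_self hr0.le⟩ fun p hp => (hfs p hp).continuousAt.continuousWithinAt
  have hPb : P ∈ ball p₀ r := by
    by_contra hPb
    have hd : dist P p₀ = r := le_antisymm hP (not_lt.1 hPb)
    have h1 : f p₀ ≤ f P := hmax (mem_closedBall_self hr0.le)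
    have h2 := (hwv p₀ (mem_closedBall_self hr0.le)).1
    have h3 := (hwv P hP).2
    have h4 := (hKp P (hrK hP)).2.2.2
    have h5 := hQd P
    have h6 : Γ p₀ = v p₀ := by simp [hΓ, hQ, hv, heq]
    have h7 : κ * r ^ 2 ≤ κ * Q P := by
      rw [hd] at h5
      exact mul_le_mul_of_nonneg_left h5 hκ0.le
    have h8 : 0 < κ * r ^ 2 := by positivity
    simp only [hf, h6] at h1
    simp only [hΓ] at h1
    linarith
  have hloc : IsLocalMax f P := hmax.isLocalMax
    (mem_of_superset (isOpen_ball.mem_nhds hPb) ball_subset_closedBall)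
  have h1 := hloc.lap_nonpos (hfs P hP) (ev n)
  rw [hf, lap_add hws.contDiffAt (contDiffAt_const.mul (hΓs P (hKH (hrK hP)))),
    lap_const_mul] at h1
  linarith [hwl P hP, (hKp P (hrK hP)).2.1]

theorem lap_rpow_snd {n : ℕ} (r : ℝ) {p : Hn n} (hp : 0 < p.2) :
    lap (ev n) (fun z => z.2 ^ r) p = r * (r - 1) * p.2 ^ (r - 2) := by
  have h : ∀ j, pd (ev n j) (pd (ev n j) fun z => z.2 ^ r) p =
      (ev n j).2 * (r * (r - 1) * p.2 ^ (r - 2)) := fun j => by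
    have h1 : pd (ev n j) (fun z => z.2 ^ r) =ᶠ[𝓝 p] fun z =>
        (r * (ev n j).2) * z.2 ^ (r - 1) := by
      filter_upwards [(isOpen_upper n).mem_nhds hp] with z hz using pd_rpow_snd r hz _
    rw [(pd_congr h1 _).eq_of_nhds, pd_const_mul, pd_rpow_snd _ hp,
      show r - 1 - 1 = r - 2 by ring]
    linear_combination (r * (r - 1) * p.2 ^ (r - 2)) * ev_snd_mul_self n j
  simp only [lap, h, sum_ev_snd]

theorem lap_rpow_mul_norm_sq {n : ℕ} (r : ℝ) {p : Hn n} (hp : 0 < p.2) :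
    lap (ev n) (fun z => z.2 ^ r * ‖z.1‖ ^ 2) p =
      2 * n * p.2 ^ r + r * (r - 1) * (p.2 ^ (r - 2) * ‖p.1‖ ^ 2) := by
  have hd : ∀ z : Hn n, DifferentiableAt ℝ (fun z : Hn n => ‖z.1‖ ^ 2) z := fun z =>
    (contDiff_fst.norm_sq ℝ (n := 1)).differentiable (by simp) z
  have hpd : ∀ e z : Hn n, pd e (fun z => ‖z.1‖ ^ 2) z = 2 * inner ℝ z.1 e.1 := fun e z => by
    simpa using pd_norm_fst_sub_sq 0 e z
  have hpi : ∀ v : En n, ∀ e z : Hn n, pd e (fun z => inner ℝ z.1 v) z = inner ℝ e.1 v :=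
    fun v e z => by simpa using pd_inner_fst_sub 0 v e z
  have h1 : ∀ j, pd (ev n j) (fun z => z.2 ^ r * ‖z.1‖ ^ 2) =ᶠ[𝓝 p] fun z =>
      z.2 ^ r * (2 * inner ℝ z.1 (ev n j).1) +
        r * (ev n j).2 * (z.2 ^ (r - 1) * ‖z.1‖ ^ 2) := fun j => by
    filter_upwards [(isOpen_upper n).mem_nhds hp] with z hz
    rw [pd_rpow_mul r hz (hd z), hpd]
  have h2 : ∀ j, pd (ev n j) (pd (ev n j) fun z => z.2 ^ r * ‖z.1‖ ^ 2) p =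
      (2 * inner ℝ (ev n j).1 (ev n j).1) * p.2 ^ r +
        (ev n j).2 * (r * (r - 1) * (p.2 ^ (r - 2) * ‖p.1‖ ^ 2)) := fun j => by
    rw [(pd_congr (h1 j) _).eq_of_nhds]
    cases j with
    | none =>
      simp only [ev, inner_zero_right, mul_zero, zero_add, mul_one]
      rw [pd_const_mul, pd_rpow_mul (r - 1) hp (hd p), hpd, show r - 1 - 1 = r - 2 by ring]
      simp
      ring
    | some i =>
      simp only [ev, mul_zero, zero_mul, add_zero]
      have hdi : DifferentiableAt ℝ (fun z : Hn n =>
          2 * inner ℝ z.1 (EuclideanSpace.single i (1 : ℝ))) p :=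
        (differentiableAt_fst.inner ℝ (differentiableAt_const _)).const_mul 2
      rw [pd_rpow_mul r hp hdi, pd_const_mul, hpi]
      simp
      ring
  simp only [lap, h2, Finset.sum_add_distrib, sum_ev_snd]
  simp only [← Finset.sum_mul, ← Finset.mul_sum]
  congr 1
  simp [Fintype.sum_option, ev]

/-- Comparison of a weak subsolution with an explicit supersolution in a cylinder of size `L`. -/
theorem WeakSub.le_barrier {n : ℕ} {a : ℝ} (ha : a ∈ Ioo (-1 : ℝ) 1) {V : Hn n → ℝ}
    (h : WeakSub n a V) (hcont : ContinuousOn V {p : Hn n | 0 ≤ p.2})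
    (hbry : ∀ x : En n, V (x, 0) ≤ 0) {M : ℝ} (hM0 : 0 < M)
    (hM : ∀ p : Hn n, 0 < p.2 → V p ≤ M) {L : ℝ} (hL : 0 < L) {p : Hn n} (hp : 0 < p.2)
    (hpL : p.2 ≤ L) (hpx : ‖p.1‖ ≤ L) :
    V p ≤ M * (‖p.1‖ ^ 2 / L ^ 2 - (n / (1 + a) + 1) * (p.2 / L) ^ 2 +
      (n / (1 + a) + 1 + 1) * (p.2 / L) ^ (1 - a)) := by
  have ha1 : 0 < 1 + a := by linarith [ha.1]
  have ha2 : 0 < 1 - a := by linarith [ha.2]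
  set κ : ℝ := n / (1 + a) + 1 with hκ
  have hκ0 : 0 < κ := by positivity
  have hκa : κ * (1 + a) = n + (1 + a) := by
    rw [hκ]
    field_simp
  set b : Hn n → ℝ := fun p => M * (‖p.1‖ ^ 2 / L ^ 2 - κ * (p.2 / L) ^ 2 +
    (κ + 1) * (p.2 / L) ^ (1 - a)) with hb
  have hbc : Continuous b := by
    have : Continuous fun p : Hn n => (p.2 / L) ^ (1 - a) :=
      (continuous_snd.div_const L).rpow_const fun _ => Or.inr ha2.le
    fun_prop
  have hblow : ∀ q : Hn n, 0 ≤ q.2 → q.2 ≤ L →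
      M * (‖q.1‖ ^ 2 / L ^ 2 + (q.2 / L) ^ (1 - a)) ≤ b q := fun q hq hqL => by
    have h0 : 0 ≤ q.2 / L := by positivity
    have h1 : q.2 / L ≤ 1 := (div_le_one hL).2 hqL
    have h2 : (q.2 / L) ^ 2 ≤ (q.2 / L) ^ (1 - a) := by
      rw [← Real.rpow_natCast]
      exact Real.rpow_le_rpow_of_exponent_ge_of_imp h0 h1 (by push_cast; linarith)
        fun _ h => absurd h (by norm_num)
    refine mul_le_mul_of_nonneg_left ?_ hM0.le
    nlinarith [mul_le_mul_of_nonneg_left h2 hκ0.le]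
  set D : Set (Hn n) := closedBall 0 L ×ˢ Icc 0 L with hD
  have hDc : IsCompact D := (isCompact_closedBall _ _).prod isCompact_Icc
  have hpD : p ∈ D := ⟨by simpa using hpx, hp.le, hpL⟩
  obtain ⟨P, hP, hmax⟩ := hDc.exists_isMaxOn ⟨p, hpD⟩
    ((hcont.mono fun q hq => hq.2.1).sub hbc.continuousOn)
  by_contra! hlt
  have hmpos : 0 < V P - b P := (sub_pos.2 hlt).trans_le (hmax hpD)
  have hPx : ‖P.1‖ ≤ L := by simpa using hP.1
  have hlow := hblow P hP.2.1 hP.2.2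
  have hrp : 0 ≤ (P.2 / L) ^ (1 - a) := Real.rpow_nonneg (div_nonneg hP.2.1 hL.le) _
  have hP0 : 0 < P.2 := by
    refine lt_of_le_of_ne hP.2.1 fun h0 => ?_
    have h1 : V P ≤ 0 := by
      have := hbry P.1
      rwa [show (P.1, (0 : ℝ)) = P from Prod.ext rfl h0] at this
    have : 0 ≤ M * (‖P.1‖ ^ 2 / L ^ 2 + (P.2 / L) ^ (1 - a)) := by positivity
    linarith
  have hbM : 1 ≤ ‖P.1‖ ^ 2 / L ^ 2 + (P.2 / L) ^ (1 - a) → False := fun h1 => by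
    nlinarith [hM P hP0]
  have hPL : P.2 < L := by
    refine lt_of_le_of_ne hP.2.2 fun h0 => hbM ?_
    rw [h0, div_self hL.ne', Real.one_rpow]
    have : 0 ≤ ‖P.1‖ ^ 2 / L ^ 2 := by positivity
    linarith
  have hPx' : ‖P.1‖ < L := by
    refine lt_of_le_of_ne hPx fun h0 => hbM ?_
    rw [h0, div_self (by positivity)]
    linarith
  set m := V P - b P with hm
  set s := a / 2 with hs
  set A := M / L ^ 2 with hA
  set C := M * (κ + 1) / L ^ (1 - a) with hC
  set Γ : Hn n → ℝ := fun z => A * (z.2 ^ s * ‖z.1‖ ^ 2) + (-(A * κ) * z.2 ^ (s + 2) +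
    (C * z.2 ^ (1 - s) + m * z.2 ^ s)) with hΓ
  have hrpow : ∀ z : Hn n, 0 < z.2 → ∀ r t : ℝ, z.2 ^ r * z.2 ^ t = z.2 ^ (r + t) :=
    fun z hz r t => (Real.rpow_add hz r t).symm
  have hbz : ∀ z : Hn n, 0 < z.2 → b z = A * ‖z.1‖ ^ 2 - A * κ * z.2 ^ (2 : ℝ) +
      C * z.2 ^ (1 - a) := fun z hz => by
    have : (z.2 / L) ^ (1 - a) = z.2 ^ (1 - a) / L ^ (1 - a) := Real.div_rpow hz.le hL.le _
    simp only [hb, hA, hC, this, div_pow, Real.rpow_two]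
    ring
  have hΓz : ∀ z : Hn n, 0 < z.2 → ∀ r : ℝ, z.2 ^ r * (b z + m) = A * (z.2 ^ r * ‖z.1‖ ^ 2) +
      (-(A * κ) * z.2 ^ (r + 2) + (C * z.2 ^ (r + 1 - a) + m * z.2 ^ r)) := fun z hz r => by
    rw [hbz z hz, ← hrpow z hz r 2, add_sub_assoc, ← hrpow z hz r (1 - a)]
    ring
  have hΓeq : ∀ z : Hn n, 0 < z.2 → z.2 ^ s * (b z + m) = Γ z := fun z hz => by
    rw [hΓz z hz s, hΓ, show s + 1 - a = 1 - s by rw [hs]; ring]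
  have hc1 : ∀ z : Hn n, 0 < z.2 → ContDiffAt ℝ ∞ (fun z => A * (z.2 ^ s * ‖z.1‖ ^ 2)) z :=
    fun z hz => contDiffAt_const.mul ((contDiffAt_rpow_snd s hz).mul (contDiffAt_fst.norm_sq ℝ))
  have hcr : ∀ c r : ℝ, ∀ z : Hn n, 0 < z.2 → ContDiffAt ℝ ∞ (fun z => c * z.2 ^ r) z :=
    fun c r z hz => contDiffAt_const.mul (contDiffAt_rpow_snd r hz)
  have hc34 : ∀ z : Hn n, 0 < z.2 → ContDiffAt ℝ ∞ (fun z =>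
      C * z.2 ^ (1 - s) + m * z.2 ^ s) z := fun z hz => (hcr _ _ z hz).add (hcr _ _ z hz)
  have hc234 : ∀ z : Hn n, 0 < z.2 → ContDiffAt ℝ ∞ (fun z =>
      -(A * κ) * z.2 ^ (s + 2) + (C * z.2 ^ (1 - s) + m * z.2 ^ s)) z := fun z hz =>
    (hcr _ _ z hz).add (hc34 z hz)
  have hnhds : D ∩ {q | 0 < q.2} ∈ 𝓝 P := by
    refine inter_mem (prod_mem_nhds ?_ (Icc_mem_nhds hP0 hPL)) ((isOpen_upper n).mem_nhds hP0)
    exact mem_of_superset (isOpen_ball.mem_nhds (by simpa using hPx')) ball_subset_closedBall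
  have key := h.lap_ge_of_touching (s := s) (by rw [hs]; ring) (Γ₀ := Γ) hP0
    (fun z hz => (hc1 z hz).add (hc234 z hz)) (by
      filter_upwards [hnhds] with q hq
      rw [← hΓeq q hq.2]
      refine mul_le_mul_of_nonneg_left ?_ (Real.rpow_nonneg (le_of_lt hq.2) _)
      have : V q - b q ≤ m := hmax hq.1
      linarith) (by rw [← hΓeq P hP0, hm]; ring)
  rw [show V P = b P + m by rw [hm]; ring, hΓz P hP0 (s - 2), hΓ,
    lap_add (hc1 P hP0) (hc234 P hP0), lap_add (hcr _ _ P hP0) (hc34 P hP0),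
    lap_add (hcr _ _ P hP0) (hcr _ _ P hP0), lap_const_mul, lap_const_mul, lap_const_mul,
    lap_const_mul, lap_rpow_mul_norm_sq s hP0, lap_rpow_snd _ hP0, lap_rpow_snd _ hP0,
    lap_rpow_snd _ hP0, show s + 2 - 2 = s by ring, show s - 2 + 2 = s by ring,
    show s - 2 + 1 - a = 1 - s - 2 by rw [hs]; ring] at key
  have hA0 : 0 < A := by positivity
  have hys : 0 < P.2 ^ s := Real.rpow_pos_of_pos hP0 s
  have h2s : a = 2 * s := by rw [hs]; ring
  have : 0 ≤ -(2 * (A * P.2 ^ s * (1 + a))) := by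
    have e : A * P.2 ^ s * (κ * (1 + a)) = A * P.2 ^ s * (n + (1 + a)) := by rw [hκa]
    rw [h2s] at e ⊢
    linarith
  have : 0 < A * P.2 ^ s * (1 + a) := by positivity
  linarith

end HalfSpace

/-- maximum principle in the half space for the weighted operator
`L_a = −div(y^a ∇·)`.  If `V` is bounded above, is a weak subsolution
(`∫ y^a ∇V·∇ξ ≤ 0` for all nonnegative `ξ ∈ C_c^∞(ℝ^{n+1}_+)`), and `V(·,0) ≤ 0` on
the boundary, then `V ≤ 0` in `ℝ^{n+1}_+`. -/
theorem half_space_maximum_principle (n : ℕ) (hn : 0 < n)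
    (a : ℝ) (ha : a ∈ Set.Ioo (-1 : ℝ) 1)
    (V : Hn n → ℝ)
    -- `V` bounded above in the half space
    (hbdd : ∃ M : ℝ, ∀ p : Hn n, 0 < p.2 → V p ≤ M)
    -- regularity of `V` (its gradient exists in the open half space)
    (hdiff : ∀ p : Hn n, 0 < p.2 → DifferentiableAt ℝ V p)
    -- `L_a V ≤ 0` weakly in `ℝ^{n+1}_+`
    (hsub : ∀ ξ : Hn n → ℝ, ContDiff ℝ (⊤ : ℕ∞) ξ → HasCompactSupport ξ →
      tsupport ξ ⊆ {p : Hn n | 0 < p.2} → (∀ p, 0 ≤ ξ p) →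
      (∫ p in {p : Hn n | 0 < p.2}, p.2 ^ a * gradDot n V ξ p) ≤ 0)
    -- `V(x,0) ≤ 0` in the trace sense (V extends continuously to the boundary,
    -- with nonpositive boundary values)
    (hcont : ContinuousOn V {p : Hn n | 0 ≤ p.2})
    (hbry : ∀ x : En n, V (x, 0) ≤ 0) :
    ∀ p : Hn n, 0 < p.2 → V p ≤ 0 := by
  obtain ⟨M, hM⟩ := hbdd
  intro p hp
  have h : WeakSub n a V := ⟨hdiff, hsub⟩
  have ha2 : 0 < 1 - a := by linarith [ha.2]
  set κ : ℝ := n / (1 + a) + 1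
  have hlim : Tendsto (fun L : ℝ => max M 1 * (‖p.1‖ ^ 2 / L ^ 2 - κ * (p.2 / L) ^ 2 +
      (κ + 1) * (p.2 / L) ^ (1 - a))) atTop (nhds (max M 1 * (0 - κ * 0 ^ 2 +
      (κ + 1) * 0 ^ (1 - a)))) := by
    have h1 : Tendsto (fun L : ℝ => p.2 / L) atTop (nhds 0) :=
      tendsto_const_nhds.div_atTop tendsto_id
    have h2 : Tendsto (fun L : ℝ => ‖p.1‖ ^ 2 / L ^ 2) atTop (nhds 0) :=
      tendsto_const_nhds.div_atTop (tendsto_pow_atTop (by norm_num))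
    exact ((h2.sub ((h1.pow 2).const_mul κ)).add
      ((h1.rpow_const (Or.inr ha2.le)).const_mul (κ + 1))).const_mul _
  rw [Real.zero_rpow ha2.ne', show max M 1 * (0 - κ * 0 ^ 2 + (κ + 1) * 0) = 0 by ring] at hlim
  refine ge_of_tendsto hlim ?_
  filter_upwards [eventually_gt_atTop 0, eventually_ge_atTop p.2, eventually_ge_atTop ‖p.1‖]
    with L hL hL2 hL1
  exact h.le_barrier ha hcont hbry (by positivity)
    (fun q hq => (hM q hq).trans (le_max_left _ _)) hL hp hL2 hL1
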